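/- arXiv:math/0109097 — 6 statements merged into one kernel-verified Lean document; each statement's English description precedes it below -/
import Mathlib

section
/- Let H be a real inner product space, let v ∈ H and ε ∈ ℝ satisfy ε²⟨v,v⟩ < 1, and let y ∈ H with y ≠ 0. Then the number F := (√(ε²⟨v,y⟩² + ⟨y,y⟩(1 − ε²⟨v,v⟩)) − ε⟨v,y⟩)/(1 − ε²⟨v,v⟩) is positive, satisfies ⟨y/F − εv, y/F − εv⟩ = 1, and is the unique positive real number t with ⟨y/t − εv, y/t − εv⟩ = 1. -/
open RealInnerProductSpace

/-- The navigation equation at `t ≠ 0` is a quadratic equation in `t`. -/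
lemma inner_inv_smul_sub_smul_self_eq_one_iff
    {H : Type*} [NormedAddCommGroup H] [InnerProductSpace ℝ H]
    (v y : H) (ε : ℝ) {t : ℝ} (ht : t ≠ 0) :
    ⟪t⁻¹ • y - ε • v, t⁻¹ • y - ε • v⟫ = 1 ↔
      t ^ 2 * (1 - ε ^ 2 * ⟪v, v⟫) + 2 * t * (ε * ⟪v, y⟫) = ⟪y, y⟫ := by
  have expand : ⟪t⁻¹ • y - ε • v, t⁻¹ • y - ε • v⟫ =
      (⟪y, y⟫ - 2 * t * (ε * ⟪v, y⟫) + t ^ 2 * (ε ^ 2 * ⟪v, v⟫)) / t ^ 2 := by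
    simp only [inner_sub_left, inner_sub_right, real_inner_smul_left, real_inner_smul_right,
      real_inner_comm v y]
    field_simp
    ring
  rw [expand, div_eq_one_iff_eq (pow_ne_zero 2 ht)]
  constructor <;> intro h <;> linarith

/-- The larger root of `l * t ^ 2 + 2 * b * t = a`, for `l, a > 0`, is its only positive root. -/
lemma pos_and_quadratic_iff_eq {l a : ℝ} (b : ℝ) (hl : 0 < l) (ha : 0 < a) (t : ℝ) :
    0 < t ∧ t ^ 2 * l + 2 * t * b = a ↔ t = (Real.sqrt (b ^ 2 + a * l) - b) / l := by
  have hal : 0 < a * l := mul_pos ha hl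
  have hsq : Real.sqrt (b ^ 2 + a * l) ^ 2 = b ^ 2 + a * l := Real.sq_sqrt (by positivity)
  rw [eq_div_iff hl.ne']
  constructor
  · rintro ⟨ht, h⟩
    have htl : 0 < t * l := mul_pos ht hl
    have h2 : 0 < t * l + 2 * b := by
      refine pos_of_mul_pos_right (a := t) ?_ ht.le
      linarith
    have hs : Real.sqrt (b ^ 2 + a * l) = t * l + b := by
      rw [Real.sqrt_eq_iff_mul_self_eq_of_pos (by linarith)]
      linear_combination l * h
    linarith
  · intro h
    have hb : b < Real.sqrt (b ^ 2 + a * l) := Real.lt_sqrt_of_sq_lt (by linarith)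
    refine ⟨pos_of_mul_pos_left (b := l) (by linarith) hl.le, ?_⟩
    apply mul_right_cancel₀ hl.ne'
    linear_combination hsq + (t * l + b + Real.sqrt (b ^ 2 + a * l)) * h

/-- Zermelo navigation on a Riemannian norm `Φ(w) = √⟪w,w⟫` in a real inner product
space: the Randers metric `F = α + β` is the unique positive solution of
`⟪y/F − εv, y/F − εv⟫ = 1`. -/
theorem navigation_inner_product_space
    {H : Type*} [NormedAddCommGroup H] [InnerProductSpace ℝ H]
    (v : H) (ε : ℝ) (hv : ε ^ 2 * ⟪v, v⟫ < 1) (y : H) (hy : y ≠ 0)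
    (F : ℝ)
    (hF : F = (Real.sqrt (ε ^ 2 * ⟪v, y⟫ ^ 2 + ⟪y, y⟫ * (1 - ε ^ 2 * ⟪v, v⟫))
        - ε * ⟪v, y⟫) / (1 - ε ^ 2 * ⟪v, v⟫)) :
    0 < F ∧ ⟪F⁻¹ • y - ε • v, F⁻¹ • y - ε • v⟫ = 1 ∧
      ∀ t : ℝ, 0 < t → ⟪t⁻¹ • y - ε • v, t⁻¹ • y - ε • v⟫ = 1 → t = F := by
  have key := pos_and_quadratic_iff_eq (ε * ⟪v, y⟫) (sub_pos.2 hv) (real_inner_self_pos.2 hy)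
  rw [← mul_pow] at hF
  obtain ⟨hpos, hquad⟩ := (key F).2 hF
  refine ⟨hpos, (inner_inv_smul_sub_smul_self_eq_one_iff v y ε hpos.ne').2 hquad, ?_⟩
  intro t ht h
  exact ((key t).1 ⟨ht, (inner_inv_smul_sub_smul_self_eq_one_iff v y ε ht.ne').1 h⟩).trans hF.symm
end

section
/- Fix ε ∈ ℝ and define E(r) = 1/((1+r²)(1+(1−ε²)r²)) and G(r) = r²(1+r²)/(1+(1−ε²)r²)². Then for every r > 0 with 1+(1−ε²)r² > 0, the Gauss curvature K(r) = −(1/(2√(E(r)G(r)))) · (d/dr)(G′(r)/√(E(r)G(r))) equals (1 − 5ε² + (1−ε⁴)r²)/(1 + (1−ε²)r²). In particular, for ε = ±1 the Gauss curvature is identically −4, and it is non-constant unless ε ∈ {0, 1, −1}. -/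
/-- Derivative of `r² (1 + r²) / (1 + c r²)²`. -/
lemma hasDerivAt_angular_coefficient (c r : ℝ) (h : 0 < 1 + c * r ^ 2) :
    HasDerivAt (fun x : ℝ => x ^ 2 * (1 + x ^ 2) / (1 + c * x ^ 2) ^ 2)
      ((2 * r + (4 - 2 * c) * r ^ 3) / (1 + c * r ^ 2) ^ 3) r := by
  have h2 : HasDerivAt (fun x : ℝ => x ^ 2) (2 * r) r := by simpa using hasDerivAt_pow 2 r
  have hD := (h2.const_mul c).const_add 1
  have hG := (h2.mul (h2.const_add 1)).div (hD.pow 2) (pow_pos h 2).ne'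
  refine hG.congr_deriv ?_
  simp only [Pi.mul_apply, Pi.pow_apply]
  rw [div_eq_div_iff (pow_ne_zero 2 (pow_ne_zero 2 h.ne')) (pow_ne_zero 3 h.ne')]
  push_cast
  ring

/-- The area density `√(E G)` in closed form. -/
lemma sqrt_area_density (c r : ℝ) (hr : 0 < r) (h : 0 < 1 + c * r ^ 2) :
    √(1 / ((1 + r ^ 2) * (1 + c * r ^ 2)) * (r ^ 2 * (1 + r ^ 2) / (1 + c * r ^ 2) ^ 2)) =
      r / ((1 + c * r ^ 2) * √(1 + c * r ^ 2)) := by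
  have hu : 0 < √(1 + c * r ^ 2) := Real.sqrt_pos.2 h
  have h1 : 0 < 1 + r ^ 2 := by positivity
  have hsq : √(1 + c * r ^ 2) ^ 2 = 1 + c * r ^ 2 := Real.sq_sqrt h.le
  rw [Real.sqrt_eq_iff_mul_self_eq (by positivity) (by positivity)]
  generalize √(1 + c * r ^ 2) = u at hu hsq ⊢
  rw [← hsq]
  field_simp

/-- Derivative of the closed form of the derivative of `G` divided by `√(E G)`. -/
lemma hasDerivAt_angular_quotient (c r : ℝ) (h : 0 < 1 + c * r ^ 2) :
    HasDerivAt (fun x : ℝ => (2 + (4 - 2 * c) * x ^ 2) / (1 + c * x ^ 2) ^ 2 * √(1 + c * x ^ 2))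
      (r * √(1 + c * r ^ 2) / (1 + c * r ^ 2) ^ 3 *
        (8 - 10 * c + (2 * c ^ 2 - 4 * c) * r ^ 2)) r := by
  have h2 : HasDerivAt (fun x : ℝ => x ^ 2) (2 * r) r := by simpa using hasDerivAt_pow 2 r
  have hD := (h2.const_mul c).const_add 1
  have hN := (h2.const_mul (4 - 2 * c)).const_add 2
  have hf := (hN.div (hD.pow 2) (pow_pos h 2).ne').mul (hD.sqrt h.ne')
  refine hf.congr_deriv ?_
  simp only [Pi.div_apply, Pi.pow_apply]
  have hu : 0 < √(1 + c * r ^ 2) := Real.sqrt_pos.2 h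
  have hsq : √(1 + c * r ^ 2) ^ 2 = 1 + c * r ^ 2 := Real.sq_sqrt h.le
  generalize √(1 + c * r ^ 2) = u at hu hsq ⊢
  rw [← hsq]
  field_simp
  push_cast
  have hc : c * r ^ 2 = u ^ 2 - 1 := by linarith
  grind

/-- The Gauss curvature of the Riemannian part `α` of the Randers metric on `S²`
obtained from Zermelo navigation on the round sphere, in polar coordinates:
`K(r) = (1 − 5ε² + (1−ε⁴)r²)/(1 + (1−ε²)r²)`.  It is `−4` for `ε = ±1`, and is
non-constant unless `ε ∈ {0, 1, −1}`. -/
theorem gauss_curvature_sphere_navigation (ε : ℝ) (E G K : ℝ → ℝ)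
    (hE : E = fun r => 1 / ((1 + r ^ 2) * (1 + (1 - ε ^ 2) * r ^ 2)))
    (hG : G = fun r => r ^ 2 * (1 + r ^ 2) / (1 + (1 - ε ^ 2) * r ^ 2) ^ 2)
    (hK : K = fun r => -(1 / (2 * Real.sqrt (E r * G r))) *
        deriv (fun s => deriv G s / Real.sqrt (E s * G s)) r) :
    (∀ r : ℝ, 0 < r → 0 < 1 + (1 - ε ^ 2) * r ^ 2 →
        K r = (1 - 5 * ε ^ 2 + (1 - ε ^ 4) * r ^ 2) / (1 + (1 - ε ^ 2) * r ^ 2)) ∧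
    ((ε = 1 ∨ ε = -1) → ∀ r : ℝ, 0 < r → K r = -4) ∧
    (ε ≠ 0 → ε ≠ 1 → ε ≠ -1 →
      ∃ r s : ℝ, (0 < r ∧ 0 < 1 + (1 - ε ^ 2) * r ^ 2) ∧
        (0 < s ∧ 0 < 1 + (1 - ε ^ 2) * s ^ 2) ∧ K r ≠ K s) := by
  have hpos : ∀ r : ℝ, 0 < r → 0 < 1 + (1 - ε ^ 2) * r ^ 2 →
      K r = (1 - 5 * ε ^ 2 + (1 - ε ^ 4) * r ^ 2) / (1 + (1 - ε ^ 2) * r ^ 2) := by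
    intro r hr h
    have hev : (fun s => deriv G s / √(E s * G s)) =ᶠ[nhds r]
        fun x => (2 + (4 - 2 * (1 - ε ^ 2)) * x ^ 2) / (1 + (1 - ε ^ 2) * x ^ 2) ^ 2 *
          √(1 + (1 - ε ^ 2) * x ^ 2) := by
      have hcont : Continuous fun x : ℝ => 1 + (1 - ε ^ 2) * x ^ 2 := by fun_prop
      filter_upwards [lt_mem_nhds hr, hcont.continuousAt.eventually (lt_mem_nhds h)] with x hx hDx
      have hu : 0 < √(1 + (1 - ε ^ 2) * x ^ 2) := Real.sqrt_pos.2 hDx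
      rw [hE, hG, (hasDerivAt_angular_coefficient _ x hDx).deriv, sqrt_area_density _ x hx hDx]
      have := hDx.ne'
      field_simp
    have hu : 0 < √(1 + (1 - ε ^ 2) * r ^ 2) := Real.sqrt_pos.2 h
    have hsq : √(1 + (1 - ε ^ 2) * r ^ 2) ^ 2 = 1 + (1 - ε ^ 2) * r ^ 2 := Real.sq_sqrt h.le
    rw [hK]
    beta_reduce
    rw [hev.deriv_eq, (hasDerivAt_angular_quotient _ r h).deriv, hE, hG,
      sqrt_area_density _ r hr h]
    generalize √(1 + (1 - ε ^ 2) * r ^ 2) = u at hu hsq ⊢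
    rw [← hsq]
    field_simp
    ring
  refine ⟨hpos, ?_, ?_⟩
  · intro hε r hr
    have h2 : ε ^ 2 = 1 := by rcases hε with rfl | rfl <;> norm_num
    have h4 : ε ^ 4 = 1 := by rw [show ε ^ 4 = (ε ^ 2) ^ 2 by ring, h2, one_pow]
    rw [hpos r hr (by simp [h2]), h2, h4]
    norm_num
  · intro h0 h1 h2
    have hc : 1 - ε ^ 2 ≠ 0 := by
      rw [show 1 - ε ^ 2 = -((ε - 1) * (ε + 1)) by ring]
      exact neg_ne_zero.2 (mul_ne_zero (sub_ne_zero.2 h1) (fun h => h2 (by linarith)))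
    have hD : ∀ t : ℝ, 0 < t → t * (1 + ε ^ 2) ≤ 1 → 0 < 1 + (1 - ε ^ 2) * t ^ 2 := by
      intro t ht hle
      have h3 : t ≤ 1 := by nlinarith [mul_nonneg ht.le (sq_nonneg ε)]
      nlinarith [mul_le_mul hle h3 ht.le zero_le_one, pow_pos ht 2]
    have hp : 0 < 1 + ε ^ 2 := by positivity
    obtain ⟨t, ht, hle⟩ : ∃ t : ℝ, 0 < t ∧ t * (1 + ε ^ 2) = 1 :=
      ⟨(1 + ε ^ 2)⁻¹, inv_pos.2 hp, inv_mul_cancel₀ hp.ne'⟩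
    have hDt := hD t ht hle.le
    have hDs := hD (t / 2) (by positivity) (by linarith)
    refine ⟨t, t / 2, ⟨ht, hDt⟩, ⟨by positivity, hDs⟩, ?_⟩
    rw [hpos t ht hDt, hpos (t / 2) (by positivity) hDs, Ne, div_eq_div_iff hDt.ne' hDs.ne']
    intro heq
    have hprod : (1 - ε ^ 2) * ε ^ 2 * t ^ 2 = 0 := by linear_combination (2 / 9) * heq
    exact mul_ne_zero (mul_ne_zero hc (pow_ne_zero 2 h0)) (pow_ne_zero 2 ht.ne') hprod
end

section
/- Fix ε ∈ ℝ and define E(r) = 1/((1−(1+ε²)r²)(1−r²)) and G(r) = r²(1−r²)/(1−(1+ε²)r²)². Then for every r with 0 < r < 1/√(1+ε²), the Gauss curvature K(r) = −(1/(2√(E(r)G(r)))) · (d/dr)(G′(r)/√(E(r)G(r))) equals (−1 − 5ε² + (1−ε⁴)r²)/(1 − (1+ε²)r²). In particular it is non-constant unless ε = 0, and for ε = 0 it is identically −1. -/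
/-- The area density `√(EG)` of the metric, with `a = 1 + ε²`. -/
theorem sqrt_klein_navigation_density {a r : ℝ} (hr : 0 < r) (hu : 0 < 1 - a * r ^ 2)
    (hv : 0 < 1 - r ^ 2) :
    √(1 / ((1 - a * r ^ 2) * (1 - r ^ 2)) * (r ^ 2 * (1 - r ^ 2) / (1 - a * r ^ 2) ^ 2)) =
      r / ((1 - a * r ^ 2) * √(1 - a * r ^ 2)) := by
  rw [Real.sqrt_eq_iff_mul_self_eq_of_pos (by positivity), ← sq, div_pow, mul_pow, Real.sq_sqrt hu.le]
  field_simp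

theorem hasDerivAt_one_sub_mul_sq (a r : ℝ) :
    HasDerivAt (fun s : ℝ => 1 - a * s ^ 2) (-(2 * a * r)) r := by
  refine (((hasDerivAt_pow 2 r).const_mul a).const_sub 1).congr_deriv ?_
  push_cast
  ring

theorem hasDerivAt_klein_navigation_angular {a r : ℝ} (hu : 0 < 1 - a * r ^ 2) :
    HasDerivAt (fun s : ℝ => s ^ 2 * (1 - s ^ 2) / (1 - a * s ^ 2) ^ 2)
      ((2 * r + (2 * a - 4) * r ^ 3) / (1 - a * r ^ 2) ^ 3) r := by
  have hden := (hasDerivAt_one_sub_mul_sq a r).pow 2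
  have hnum := (hasDerivAt_pow 2 r).mul ((hasDerivAt_pow 2 r).const_sub 1)
  refine (hnum.div hden (pow_pos hu 2).ne').congr_deriv ?_
  simp only [Pi.mul_apply, Pi.pow_apply]
  push_cast
  field_simp
  ring

theorem hasDerivAt_klein_navigation_quotient {a r : ℝ} (hu : 0 < 1 - a * r ^ 2) :
    HasDerivAt (fun s : ℝ => (2 + (2 * a - 4) * s ^ 2) / ((1 - a * s ^ 2) * √(1 - a * s ^ 2)))
      (2 * r * (5 * a - 4 + a * (a - 2) * r ^ 2) /
        ((1 - a * r ^ 2) ^ 2 * √(1 - a * r ^ 2))) r := by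
  have hd := hasDerivAt_one_sub_mul_sq a r
  have hnum := ((hasDerivAt_pow 2 r).const_mul (2 * a - 4)).const_add 2
  have hsq : √(1 - a * r ^ 2) ^ 2 = 1 - a * r ^ 2 := Real.sq_sqrt hu.le
  have hpos : 0 < √(1 - a * r ^ 2) := Real.sqrt_pos.2 hu
  refine (hnum.div (hd.mul (hd.sqrt hu.ne')) (mul_pos hu hpos).ne').congr_deriv ?_
  simp only [Pi.mul_apply]
  push_cast
  generalize √(1 - a * r ^ 2) = q at hsq hpos
  rw [← hsq]
  field_simp
  rw [hsq]
  ring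

theorem klein_navigation_curvature {a r : ℝ} (ha : 1 ≤ a) (hr : 0 < r)
    (hu : 0 < 1 - a * r ^ 2) :
    -(1 / (2 * √(1 / ((1 - a * r ^ 2) * (1 - r ^ 2)) *
        (r ^ 2 * (1 - r ^ 2) / (1 - a * r ^ 2) ^ 2)))) *
      deriv (fun s : ℝ => deriv (fun t : ℝ => t ^ 2 * (1 - t ^ 2) / (1 - a * t ^ 2) ^ 2) s /
        √(1 / ((1 - a * s ^ 2) * (1 - s ^ 2)) *
          (s ^ 2 * (1 - s ^ 2) / (1 - a * s ^ 2) ^ 2))) r =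
      -(5 * a - 4 + a * (a - 2) * r ^ 2) / (1 - a * r ^ 2) := by
  have hv {s : ℝ} (hs : 0 < 1 - a * s ^ 2) : 0 < 1 - s ^ 2 := by
    nlinarith [mul_nonneg (sub_nonneg.2 ha) (sq_nonneg s)]
  have hnear : ∀ᶠ s in nhds r, 0 < 1 - a * s ^ 2 :=
    (hasDerivAt_one_sub_mul_sq a r).continuousAt.eventually_const_lt hu
  have heq : (fun s : ℝ => deriv (fun t : ℝ => t ^ 2 * (1 - t ^ 2) / (1 - a * t ^ 2) ^ 2) s /
        √(1 / ((1 - a * s ^ 2) * (1 - s ^ 2)) *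
          (s ^ 2 * (1 - s ^ 2) / (1 - a * s ^ 2) ^ 2))) =ᶠ[nhds r]
      fun s : ℝ => (2 + (2 * a - 4) * s ^ 2) / ((1 - a * s ^ 2) * √(1 - a * s ^ 2)) := by
    filter_upwards [hnear, eventually_gt_nhds hr] with s hs hs0
    rw [(hasDerivAt_klein_navigation_angular hs).deriv,
      sqrt_klein_navigation_density hs0 hs (hv hs)]
    have hsq : √(1 - a * s ^ 2) ^ 2 = 1 - a * s ^ 2 := Real.sq_sqrt hs.le
    have hpos : 0 < √(1 - a * s ^ 2) := Real.sqrt_pos.2 hs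
    generalize √(1 - a * s ^ 2) = q at hsq hpos
    rw [← hsq]
    field_simp
  rw [heq.deriv_eq, (hasDerivAt_klein_navigation_quotient hu).deriv,
    sqrt_klein_navigation_density hr hu (hv hu)]
  have hpos : 0 < √(1 - a * r ^ 2) := Real.sqrt_pos.2 hu
  generalize √(1 - a * r ^ 2) = q at hpos
  generalize 1 - a * r ^ 2 = u at hu
  field_simp


/-- The Gauss curvature of the Riemannian part `α` of the Randers metric on the
disk `D²(1/√(1+ε²))` obtained from Zermelo navigation on the Klein metric, in
polar coordinates: `K(r) = (−1 − 5ε² + (1−ε⁴)r²)/(1 − (1+ε²)r²)`.  It is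
non-constant unless `ε = 0`, and for `ε = 0` it is identically `−1`. -/
theorem gauss_curvature_klein_navigation (ε : ℝ) (E G K : ℝ → ℝ)
    (hE : E = fun r => 1 / ((1 - (1 + ε ^ 2) * r ^ 2) * (1 - r ^ 2)))
    (hG : G = fun r => r ^ 2 * (1 - r ^ 2) / (1 - (1 + ε ^ 2) * r ^ 2) ^ 2)
    (hK : K = fun r => -(1 / (2 * Real.sqrt (E r * G r))) *
        deriv (fun s => deriv G s / Real.sqrt (E s * G s)) r) :
    (∀ r : ℝ, 0 < r → r < 1 / Real.sqrt (1 + ε ^ 2) →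
        K r = (-1 - 5 * ε ^ 2 + (1 - ε ^ 4) * r ^ 2) / (1 - (1 + ε ^ 2) * r ^ 2)) ∧
    (ε ≠ 0 →
      ∃ r s : ℝ, (0 < r ∧ r < 1 / Real.sqrt (1 + ε ^ 2)) ∧
        (0 < s ∧ s < 1 / Real.sqrt (1 + ε ^ 2)) ∧ K r ≠ K s) ∧
    (ε = 0 → ∀ r : ℝ, 0 < r → r < 1 / Real.sqrt (1 + ε ^ 2) → K r = -1) := by
  have ha : 1 ≤ 1 + ε ^ 2 := le_add_of_nonneg_right (sq_nonneg ε)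
  have ha0 : 0 < 1 + ε ^ 2 := by linarith
  have hmain : ∀ r : ℝ, 0 < r → r < 1 / √(1 + ε ^ 2) →
      K r = (-1 - 5 * ε ^ 2 + (1 - ε ^ 4) * r ^ 2) / (1 - (1 + ε ^ 2) * r ^ 2) := by
    intro r hr hr1
    have hu : 0 < 1 - (1 + ε ^ 2) * r ^ 2 := by
      have h : r ^ 2 < (1 / √(1 + ε ^ 2)) ^ 2 := by gcongr
      rw [div_pow, Real.sq_sqrt ha0.le, lt_div_iff₀ ha0] at h
      linarith
    simp only [hK, hE, hG]
    rw [klein_navigation_curvature ha hr hu]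
    congr 1
    ring
  refine ⟨hmain, fun hε => ?_, ?_⟩
  · have hs : 0 < √(1 + ε ^ 2) := Real.sqrt_pos.2 ha0
    have hmem {c : ℝ} (hc : 1 < c) :
        0 < 1 / (c * √(1 + ε ^ 2)) ∧ 1 / (c * √(1 + ε ^ 2)) < 1 / √(1 + ε ^ 2) :=
      ⟨by positivity, one_div_lt_one_div_of_lt hs (lt_mul_of_one_lt_left hs hc)⟩
    have h2 := hmem (c := 2) (by norm_num)
    have h3 := hmem (c := 3) (by norm_num)
    refine ⟨_, _, h2, h3, ?_⟩
    rw [hmain _ h2.1 h2.2, hmain _ h3.1 h3.2]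
    simp only [div_pow, mul_pow, Real.sq_sqrt ha0.le]
    have hε2 : 0 < ε ^ 2 := by positivity
    have hden (c : ℝ) :
        1 - (1 + ε ^ 2) * (1 ^ 2 / (c ^ 2 * (1 + ε ^ 2))) = 1 - 1 / c ^ 2 := by
      field_simp
    have hnum (c : ℝ) :
        (1 - ε ^ 4) * (1 ^ 2 / (c ^ 2 * (1 + ε ^ 2))) = (1 - ε ^ 2) / c ^ 2 := by
      rw [show 1 - ε ^ 4 = (1 - ε ^ 2) * (1 + ε ^ 2) by ring]
      field_simp
    rw [hden, hden, hnum, hnum]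
    intro h
    norm_num at h
    linarith
  · rintro rfl r hr hr1
    have hr2 : r < 1 := by simpa using hr1
    have hne : 1 - r ^ 2 ≠ 0 := by nlinarith
    rw [hmain r hr hr1, div_eq_iff (by simpa using hne)]
    ring
end

section
/- Fix ε ∈ ℝ. In coordinates (x¹,x²) = (r,θ), consider the Riemannian metric with a₁₁(r) = 1/((1+r²)(1+(1−ε²)r²)), a₁₂ = a₂₁ = 0, a₂₂(r) = r²(1+r²)/(1+(1−ε²)r²)², and the 1-form with b₁ = 0, b₂(r) = −εr²/(1+(1−ε²)r²). Then for every r > 0 with 1+(1−ε²)r² > 0, the tensor e_{ij} := r_{ij} + b_i s_j + b_j s_i vanishes identically: e_{ij} = 0 for all i, j ∈ {1,2}. (This is equivalent to the vanishing of the S-curvature of the Randers metric F = α + β.) -/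
noncomputable section

/-- Partial derivative in coordinates `(x¹,x²) = (r,θ)` for data depending only
on `r`: `∂/∂x¹ = d/dr` and `∂/∂x² = 0`. -/
def pder (i : Fin 2) (f : ℝ → ℝ) : ℝ → ℝ := if i = 0 then deriv f else 0

/-- The inverse `(a^{ij})` of the metric coefficient matrix `(a_{ij})`. -/
def aInv (a : Fin 2 → Fin 2 → ℝ → ℝ) (r : ℝ) : Matrix (Fin 2) (Fin 2) ℝ :=
  (Matrix.of fun i j => a i j r)⁻¹

/-- Christoffel symbols `Γ^k_{ij} = ½ a^{kl}(∂_i a_{jl} + ∂_j a_{il} − ∂_l a_{ij})`. -/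
def christoffel (a : Fin 2 → Fin 2 → ℝ → ℝ) (k i j : Fin 2) (r : ℝ) : ℝ :=
  (1 / 2) * ∑ l, aInv a r k l * (pder i (a j l) r + pder j (a i l) r - pder l (a i j) r)

/-- Covariant derivative `b_{i|j} = ∂b_i/∂x^j − b_k Γ^k_{ij}`. -/
def bcov (a : Fin 2 → Fin 2 → ℝ → ℝ) (b : Fin 2 → ℝ → ℝ) (i j : Fin 2) (r : ℝ) : ℝ :=
  pder j (b i) r - ∑ k, b k r * christoffel a k i j r

/-- `r_{ij} = ½(b_{i|j} + b_{j|i})`. -/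
def rTensor (a : Fin 2 → Fin 2 → ℝ → ℝ) (b : Fin 2 → ℝ → ℝ) (i j : Fin 2) (r : ℝ) : ℝ :=
  (1 / 2) * (bcov a b i j r + bcov a b j i r)

/-- `s_{ij} = ½(b_{i|j} − b_{j|i})`. -/
def sTensor (a : Fin 2 → Fin 2 → ℝ → ℝ) (b : Fin 2 → ℝ → ℝ) (i j : Fin 2) (r : ℝ) : ℝ :=
  (1 / 2) * (bcov a b i j r - bcov a b j i r)

/-- `s^i_j = a^{ih} s_{hj}`. -/
def sUp (a : Fin 2 → Fin 2 → ℝ → ℝ) (b : Fin 2 → ℝ → ℝ) (i j : Fin 2) (r : ℝ) : ℝ :=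
  ∑ h, aInv a r i h * sTensor a b h j r

/-- `s_j = b_i s^i_j`. -/
def sLow (a : Fin 2 → Fin 2 → ℝ → ℝ) (b : Fin 2 → ℝ → ℝ) (j : Fin 2) (r : ℝ) : ℝ :=
  ∑ i, b i r * sUp a b i j r

/-- `e_{ij} = r_{ij} + b_i s_j + b_j s_i`. -/
def eTensor (a : Fin 2 → Fin 2 → ℝ → ℝ) (b : Fin 2 → ℝ → ℝ) (i j : Fin 2) (r : ℝ) : ℝ :=
  rTensor a b i j r + b i r * sLow a b j r + b j r * sLow a b i r

end

/-- For a diagonal metric, the inverse metric is diagonal with inverted entries. -/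
lemma aInv_of_diagonal (a : Fin 2 → Fin 2 → ℝ → ℝ) (h₀₁ : a 0 1 = 0) (h₁₀ : a 1 0 = 0) (r : ℝ)
    (h₀ : a 0 0 r ≠ 0) (h₁ : a 1 1 r ≠ 0) :
    aInv a r = !![(a 0 0 r)⁻¹, 0; 0, (a 1 1 r)⁻¹] := by
  unfold aInv
  refine Matrix.inv_eq_right_inv ?_
  ext i j
  fin_cases i <;> fin_cases j <;> simp [Matrix.mul_apply, Fin.sum_univ_two, h₀₁, h₁₀, h₀, h₁]

/-- For a diagonal metric and a 1-form with only a `θ`-component, `e_{ij}` vanishes as soon as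
the single equation `b₂' a₂₂ - b₂ a₂₂' + b₂² b₂' = 0` holds. -/
lemma eTensor_eq_zero_of_diagonal (a : Fin 2 → Fin 2 → ℝ → ℝ) (b : Fin 2 → ℝ → ℝ)
    (h₀₁ : a 0 1 = 0) (h₁₀ : a 1 0 = 0) (hb : b 0 = 0) (r : ℝ)
    (h₀ : a 0 0 r ≠ 0) (h₁ : a 1 1 r ≠ 0)
    (h : deriv (b 1) r * a 1 1 r - b 1 r * deriv (a 1 1) r + b 1 r ^ 2 * deriv (b 1) r = 0)
    (i j : Fin 2) : eTensor a b i j r = 0 := by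
  have hinv := aInv_of_diagonal a h₀₁ h₁₀ r h₀ h₁
  fin_cases i <;> fin_cases j <;>
    simp [eTensor, rTensor, sLow, sUp, sTensor, bcov, christoffel, pder, Fin.sum_univ_two,
      hinv, h₀₁, h₁₀, hb] <;>
    field_simp <;> linear_combination 2 * h

/-- For the Randers data `(α, β)` on `S²` obtained from Zermelo navigation on the
round sphere, written in polar coordinates, the tensor `e_{ij}` vanishes; this is
equivalent to the vanishing of the S-curvature of `F = α + β`. -/
theorem eTensor_vanishes_sphere_navigation (ε : ℝ)
    (a : Fin 2 → Fin 2 → ℝ → ℝ) (b : Fin 2 → ℝ → ℝ)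
    (ha : a = fun i j r =>
      !![1 / ((1 + r ^ 2) * (1 + (1 - ε ^ 2) * r ^ 2)), 0;
         0, r ^ 2 * (1 + r ^ 2) / (1 + (1 - ε ^ 2) * r ^ 2) ^ 2] i j)
    (hb : b = fun i r => ![0, -ε * r ^ 2 / (1 + (1 - ε ^ 2) * r ^ 2)] i) :
    ∀ r : ℝ, 0 < r → 0 < 1 + (1 - ε ^ 2) * r ^ 2 →
      ∀ i j : Fin 2, eTensor a b i j r = 0 := by
  intro r hr hD i j
  have hD' := hD.ne'
  have hr' := hr.ne'
  have hpos : (0 : ℝ) < 1 + r ^ 2 := by positivity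
  have hden : HasDerivAt (fun x : ℝ => 1 + (1 - ε ^ 2) * x ^ 2) ((1 - ε ^ 2) * (2 * r)) r := by
    simpa using ((hasDerivAt_pow 2 r).const_mul (1 - ε ^ 2)).const_add 1
  have hsq : HasDerivAt (fun x : ℝ => x ^ 2) (2 * r) r := by
    simpa using hasDerivAt_pow 2 r
  have hb₁ : HasDerivAt (b 1) (-(2 * ε * r) / (1 + (1 - ε ^ 2) * r ^ 2) ^ 2) r := by
    subst hb
    refine ((hsq.const_mul (-ε)).div hden hD').congr_deriv ?_
    field_simp
    ring
  have ha₁₁ : HasDerivAt (a 1 1)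
      ((2 * r + 4 * r ^ 3) / (1 + (1 - ε ^ 2) * r ^ 2) ^ 2
        - 4 * (1 - ε ^ 2) * r ^ 3 * (1 + r ^ 2) / (1 + (1 - ε ^ 2) * r ^ 2) ^ 3) r := by
    subst ha
    refine ((hsq.mul (hsq.const_add 1)).div (hden.pow 2) (pow_ne_zero 2 hD')).congr_deriv ?_
    simp
    field_simp
    ring
  refine eTensor_eq_zero_of_diagonal a b ?_ ?_ ?_ r ?_ ?_ ?_ i j
  · subst ha; ext x; simp
  · subst ha; ext x; simp
  · subst hb; ext x; simp
  · subst ha; simp [hD', hpos.ne']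
  · subst ha; simp [hD', hpos.ne', hr']
  · rw [hb₁.deriv, ha₁₁.deriv]
    subst ha hb
    simp
    field_simp
    ring
end

section
/- Fix ε ∈ ℝ. In coordinates (x¹,x²) = (r,θ), consider the Riemannian metric with a₁₁(r) = 1/((1+r²)(1+(1−ε²)r²)), a₁₂ = a₂₁ = 0, a₂₂(r) = r²(1+r²)/(1+(1−ε²)r²)², and the 1-form with b₁ = 0, b₂(r) = −εr²/(1+(1−ε²)r²). Then for every r > 0 with 1+(1−ε²)r² > 0, the symmetrized covariant derivative satisfies r₁₂ = ε³r³/((1+r²)(1+(1−ε²)r²)²). In particular, if ε ≠ 0 then r₁₂ ≠ 0 for r > 0, so the 1-form β is not a Killing form with respect to α. -/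
/-- For a diagonal metric and a 1-form `b₂ dθ`, one has `r₁₂ = ½(b₂' − b₂ a₂₂' / a₂₂)`. -/
lemma rTensor_zero_one_of_diagonal {a : Fin 2 → Fin 2 → ℝ → ℝ} {b : Fin 2 → ℝ → ℝ} {r : ℝ}
    (h01 : a 0 1 = 0) (h10 : a 1 0 = 0) (hb : b 0 = 0) (h00 : a 0 0 r ≠ 0) (h11 : a 1 1 r ≠ 0) :
    rTensor a b 0 1 r = (deriv (b 1) r - b 1 r * (deriv (a 1 1) r / a 1 1 r)) / 2 := by
  have hinv : aInv a r = !![(a 0 0 r)⁻¹, 0; 0, (a 1 1 r)⁻¹] := by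
    refine Matrix.inv_eq_right_inv ?_
    ext i j
    fin_cases i <;> fin_cases j <;> simp [Matrix.mul_apply, h01, h10, h00, h11]
  simp [rTensor, bcov, christoffel, hinv, pder, h01, h10, hb]
  ring

/-- For the Randers data `(α, β)` on `S²` obtained from Zermelo navigation on
the round sphere, written in polar coordinates, the symmetrized covariant
derivative satisfies `r₁₂ = ε³r³/((1+r²)(1+(1−ε²)r²)²)`; in particular, when
`ε ≠ 0` it is nonzero for `r > 0`, so `β` is not a Killing form for `α`. -/
theorem rTensor_sphere_navigation (ε : ℝ)
    (a : Fin 2 → Fin 2 → ℝ → ℝ) (b : Fin 2 → ℝ → ℝ)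
    (ha : a = fun i j r =>
      !![1 / ((1 + r ^ 2) * (1 + (1 - ε ^ 2) * r ^ 2)), 0;
         0, r ^ 2 * (1 + r ^ 2) / (1 + (1 - ε ^ 2) * r ^ 2) ^ 2] i j)
    (hb : b = fun i r => ![0, -ε * r ^ 2 / (1 + (1 - ε ^ 2) * r ^ 2)] i) :
    (∀ r : ℝ, 0 < r → 0 < 1 + (1 - ε ^ 2) * r ^ 2 →
      rTensor a b 0 1 r = ε ^ 3 * r ^ 3 / ((1 + r ^ 2) * (1 + (1 - ε ^ 2) * r ^ 2) ^ 2)) ∧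
    (ε ≠ 0 → ∀ r : ℝ, 0 < r → 0 < 1 + (1 - ε ^ 2) * r ^ 2 →
      rTensor a b 0 1 r ≠ 0) := by
  have key : ∀ r : ℝ, 0 < r → 0 < 1 + (1 - ε ^ 2) * r ^ 2 →
      rTensor a b 0 1 r = ε ^ 3 * r ^ 3 / ((1 + r ^ 2) * (1 + (1 - ε ^ 2) * r ^ 2) ^ 2) := by
    intro r hr hD
    have hr2 : 0 < 1 + r ^ 2 := by positivity
    have hsq : HasDerivAt (fun x : ℝ => x ^ 2) (2 * r) r := by
      simpa using hasDerivAt_pow 2 r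
    have hden : HasDerivAt (fun x : ℝ => 1 + (1 - ε ^ 2) * x ^ 2) ((1 - ε ^ 2) * (2 * r)) r :=
      (hsq.const_mul _).const_add 1
    have b1 : b 1 = fun x => -ε * x ^ 2 / (1 + (1 - ε ^ 2) * x ^ 2) := by ext; simp [hb]
    have a11 : a 1 1 = fun x => x ^ 2 * (1 + x ^ 2) / (1 + (1 - ε ^ 2) * x ^ 2) ^ 2 := by
      ext; simp [ha]
    have hb1 := (hsq.const_mul (-ε)).fun_div hden hD.ne'
    have ha11 := (hsq.fun_mul (hsq.const_add 1)).fun_div (hden.fun_pow 2) (pow_pos hD 2).ne'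
    have h00 : a 0 0 r ≠ 0 := by
      rw [ha]
      exact (one_div_pos.2 (mul_pos hr2 hD)).ne'
    have h11 : a 1 1 r ≠ 0 := by
      rw [a11]
      positivity
    rw [rTensor_zero_one_of_diagonal (by ext; simp [ha]) (by ext; simp [ha]) (by ext; simp [hb])
      h00 h11, a11, b1, hb1.deriv, ha11.deriv]
    have hD' : 1 + r ^ 2 * (1 - ε ^ 2) ≠ 0 := by rw [mul_comm]; exact hD.ne'
    field_simp
    ring
  refine ⟨key, fun hε r hr hD => ?_⟩
  rw [key r hr hD]
  positivity
end

section
/- Fix ε ∈ ℝ. On the domain of points (r,θ,μ,ν) with r > 0, 1+(1−ε²)r² > 0 and (μ,ν) ≠ (0,0), define F(r,θ,μ,ν) := (√((1+(1−ε²)r²)μ² + r²(1+r²)²ν²)/√(1+r²) − εr²ν)/(1+(1−ε²)r²). Then F > 0, the fundamental tensor (g_{ij}) of F is positive definite, and the Riemann curvature coefficients of F satisfy R^i_k = F²δ^i_k − F(∂F/∂y^k)y^i for all i, k ∈ {1,2}; that is, F has constant flag curvature K = 1. -/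
noncomputable section

/-- Partial derivative in the base coordinate `x^i` of a function of `(x, y)`. -/
def pdx (i : Fin 2) (f : (Fin 2 → ℝ) → (Fin 2 → ℝ) → ℝ) :
    (Fin 2 → ℝ) → (Fin 2 → ℝ) → ℝ :=
  fun x y => deriv (fun t => f (Function.update x i t) y) (x i)

/-- Partial derivative in the fibre coordinate `y^i` of a function of `(x, y)`. -/
def pdy (i : Fin 2) (f : (Fin 2 → ℝ) → (Fin 2 → ℝ) → ℝ) :
    (Fin 2 → ℝ) → (Fin 2 → ℝ) → ℝ :=
  fun x y => deriv (fun t => f x (Function.update y i t)) (y i)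

/-- The fundamental tensor `g_{ij} = ½ ∂²(F²)/∂y^i∂y^j` of a Finsler metric `F`. -/
def fundTensor (F : (Fin 2 → ℝ) → (Fin 2 → ℝ) → ℝ) (i j : Fin 2) :
    (Fin 2 → ℝ) → (Fin 2 → ℝ) → ℝ :=
  fun x y => (1 / 2) * pdy i (pdy j fun x y => F x y ^ 2) x y

/-- The fundamental tensor as a matrix. -/
def fundMatrix (F : (Fin 2 → ℝ) → (Fin 2 → ℝ) → ℝ) (x y : Fin 2 → ℝ) :
    Matrix (Fin 2) (Fin 2) ℝ :=
  Matrix.of fun i j => fundTensor F i j x y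

/-- The geodesic (spray) coefficients
`G^i = ¼ g^{ik}(2 ∂g_{pk}/∂x^q − ∂g_{pq}/∂x^k) y^p y^q`. -/
def sprayCoeff (F : (Fin 2 → ℝ) → (Fin 2 → ℝ) → ℝ) (i : Fin 2) :
    (Fin 2 → ℝ) → (Fin 2 → ℝ) → ℝ :=
  fun x y => (1 / 4) * ∑ k, (fundMatrix F x y)⁻¹ i k *
    ∑ p, ∑ q, (2 * pdx q (fundTensor F p k) x y - pdx k (fundTensor F p q) x y) * y p * y q

/-- The Riemann curvature coefficients
`R^i_k = 2∂G^i/∂x^k − y^j ∂²G^i/∂x^j∂y^k + 2G^j ∂²G^i/∂y^j∂y^k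
  − (∂G^i/∂y^j)(∂G^j/∂y^k)`. -/
def riemCoeff (F : (Fin 2 → ℝ) → (Fin 2 → ℝ) → ℝ) (i k : Fin 2) :
    (Fin 2 → ℝ) → (Fin 2 → ℝ) → ℝ :=
  fun x y =>
    2 * pdx k (sprayCoeff F i) x y
      - ∑ j, y j * pdx j (pdy k (sprayCoeff F i)) x y
      + 2 * ∑ j, sprayCoeff F j x y * pdy j (pdy k (sprayCoeff F i)) x y
      - ∑ j, pdy j (sprayCoeff F i) x y * pdy k (sprayCoeff F j) x y

end

section PartialDerivatives

variable {U : Set ((Fin 2 → ℝ) × (Fin 2 → ℝ))} {f : (Fin 2 → ℝ) → (Fin 2 → ℝ) → ℝ}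
  {φ : ℝ → ℝ → ℝ → ℝ} {φ' : ℝ} {x y : Fin 2 → ℝ}

theorem eventually_update_base (hU : IsOpen U) (hxy : (x, y) ∈ U) (i : Fin 2) :
    ∀ᶠ t in nhds (x i), (Function.update x i t, y) ∈ U := by
  have hc : Continuous fun t : ℝ => (Function.update x i t, y) := by fun_prop
  exact hc.continuousAt.eventually (hU.mem_nhds (by simpa using hxy))

theorem eventually_update_fibre (hU : IsOpen U) (hxy : (x, y) ∈ U) (i : Fin 2) :
    ∀ᶠ t in nhds (y i), (x, Function.update y i t) ∈ U := by
  have hc : Continuous fun t : ℝ => (x, Function.update y i t) := by fun_prop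
  exact hc.continuousAt.eventually (hU.mem_nhds (by simpa using hxy))

theorem pdx_zero_eq (hU : IsOpen U) (hf : ∀ x y, (x, y) ∈ U → f x y = φ (x 0) (y 0) (y 1))
    (hxy : (x, y) ∈ U) (hd : HasDerivAt (fun t => φ t (y 0) (y 1)) φ' (x 0)) :
    pdx 0 f x y = φ' := by
  refine (hd.congr_of_eventuallyEq ?_).deriv
  filter_upwards [eventually_update_base hU hxy 0] with t ht
  simpa using hf _ _ ht

theorem pdx_one_eq (hU : IsOpen U) (hf : ∀ x y, (x, y) ∈ U → f x y = φ (x 0) (y 0) (y 1))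
    (hxy : (x, y) ∈ U) : pdx 1 f x y = 0 := by
  refine ((hasDerivAt_const (x 1) (φ (x 0) (y 0) (y 1))).congr_of_eventuallyEq ?_).deriv
  filter_upwards [eventually_update_base hU hxy 1] with t ht
  simpa using hf _ _ ht

theorem pdy_zero_eq (hU : IsOpen U) (hf : ∀ x y, (x, y) ∈ U → f x y = φ (x 0) (y 0) (y 1))
    (hxy : (x, y) ∈ U) (hd : HasDerivAt (fun t => φ (x 0) t (y 1)) φ' (y 0)) :
    pdy 0 f x y = φ' := by
  refine (hd.congr_of_eventuallyEq ?_).deriv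
  filter_upwards [eventually_update_fibre hU hxy 0] with t ht
  simpa using hf _ _ ht

theorem pdy_one_eq (hU : IsOpen U) (hf : ∀ x y, (x, y) ∈ U → f x y = φ (x 0) (y 0) (y 1))
    (hxy : (x, y) ∈ U) (hd : HasDerivAt (fun t => φ (x 0) (y 0) t) φ' (y 1)) :
    pdy 1 f x y = φ' := by
  refine (hd.congr_of_eventuallyEq ?_).deriv
  filter_upwards [eventually_update_fibre hU hxy 1] with t ht
  simpa using hf _ _ ht

end PartialDerivatives

section DiagonalNorm

/-- The Euclidean norm of the diagonal quadratic form `a m² + b n²`. -/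
noncomputable def diagNorm (a b m n : ℝ) : ℝ := √(a * m ^ 2 + b * n ^ 2)

variable {a b m n : ℝ}

theorem diagNorm_sq (h : 0 < a * m ^ 2 + b * n ^ 2) :
    diagNorm a b m n ^ 2 = a * m ^ 2 + b * n ^ 2 := Real.sq_sqrt h.le

theorem diagNorm_pos (h : 0 < a * m ^ 2 + b * n ^ 2) : 0 < diagNorm a b m n := Real.sqrt_pos.2 h

/-- The derivative of `diagNorm` along a curve, in terms of that of the quadratic form. -/
theorem hasDerivAt_diagNorm {α β μ ν : ℝ → ℝ} {t q : ℝ}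
    (h : 0 < α t * μ t ^ 2 + β t * ν t ^ 2)
    (hq : HasDerivAt (fun s => α s * μ s ^ 2 + β s * ν s ^ 2) q t) :
    HasDerivAt (fun s => diagNorm (α s) (β s) (μ s) (ν s))
      (diagNorm (α t) (β t) (μ t) (ν t) * (q / (2 * (α t * μ t ^ 2 + β t * ν t ^ 2)))) t := by
  refine (hq.sqrt h.ne').congr_deriv ?_
  have hs := diagNorm_sq h
  have hp := diagNorm_pos h
  change q / (2 * diagNorm (α t) (β t) (μ t) (ν t)) = _
  rw [← hs]
  field_simp

/-- The derivative of `diagNorm * z / (quadratic form) ^ k` along a curve. -/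
theorem hasDerivAt_diagNorm_mul_div {α β μ ν z : ℝ → ℝ} {t q z' : ℝ} (k : ℕ)
    (h : 0 < α t * μ t ^ 2 + β t * ν t ^ 2)
    (hq : HasDerivAt (fun s => α s * μ s ^ 2 + β s * ν s ^ 2) q t) (hz : HasDerivAt z z' t) :
    HasDerivAt (fun s => diagNorm (α s) (β s) (μ s) (ν s) *
        (z s / (α s * μ s ^ 2 + β s * ν s ^ 2) ^ k))
      (diagNorm (α t) (β t) (μ t) (ν t) *
        ((z' * (α t * μ t ^ 2 + β t * ν t ^ 2) + (1 / 2 - k) * z t * q) /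
          (α t * μ t ^ 2 + β t * ν t ^ 2) ^ (k + 1))) t := by
  refine ((hasDerivAt_diagNorm h hq).mul (hz.div (hq.pow k) (pow_pos h k).ne')).congr_deriv ?_
  simp only [Pi.div_apply, Pi.pow_apply]
  generalize α t * μ t ^ 2 + β t * ν t ^ 2 = p at h ⊢
  have := h.ne'
  rcases k with _ | k
  · field_simp
    simp
    ring
  · simp only [Nat.add_sub_cancel]
    field_simp
    push_cast
    ring

theorem hasDerivAt_diagForm_left :
    HasDerivAt (fun s => a * s ^ 2 + b * n ^ 2) (2 * a * m) m :=
  (((hasDerivAt_pow 2 m).const_mul a).add_const _).congr_deriv (by norm_num; ring)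

theorem hasDerivAt_diagForm_right :
    HasDerivAt (fun s => a * m ^ 2 + b * s ^ 2) (2 * b * n) n :=
  (((hasDerivAt_pow 2 n).const_mul b).const_add _).congr_deriv (by norm_num; ring)

theorem hasDerivAt_diagForm_coeff {α β : ℝ → ℝ} {α' β' t : ℝ}
    (hα : HasDerivAt α α' t) (hβ : HasDerivAt β β' t) :
    HasDerivAt (fun s => α s * m ^ 2 + β s * n ^ 2) (α' * m ^ 2 + β' * n ^ 2) t :=
  (hα.mul_const _).add (hβ.mul_const _)

end DiagonalNorm

section RandersTerm

/-- The function `c + d · N · z / (N²) ^ k` with `N` the norm of the diagonal form `a m² + b n²`. -/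
noncomputable def randersTerm (k : ℕ) (c d z a b m n : ℝ) : ℝ :=
  c + d * (diagNorm a b m n * (z / (a * m ^ 2 + b * n ^ 2) ^ k))

theorem hasDerivAt_randersTerm {α β μ ν c d z : ℝ → ℝ} {t q c' d' z' : ℝ} (k : ℕ)
    (h : 0 < α t * μ t ^ 2 + β t * ν t ^ 2)
    (hq : HasDerivAt (fun s => α s * μ s ^ 2 + β s * ν s ^ 2) q t)
    (hc : HasDerivAt c c' t) (hd : HasDerivAt d d' t) (hz : HasDerivAt z z' t) :
    HasDerivAt (fun s => randersTerm k (c s) (d s) (z s) (α s) (β s) (μ s) (ν s))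
      (randersTerm (k + 1) c'
        1 (d' * z t * (α t * μ t ^ 2 + β t * ν t ^ 2)
          + d t * (z' * (α t * μ t ^ 2 + β t * ν t ^ 2) + (1 / 2 - k) * z t * q))
        (α t) (β t) (μ t) (ν t)) t := by
  refine (hc.add (hd.mul (hasDerivAt_diagNorm_mul_div k h hq hz))).congr_deriv ?_
  have := h.ne'
  unfold randersTerm
  generalize α t * μ t ^ 2 + β t * ν t ^ 2 = p at this ⊢
  field_simp
  ring

theorem randersTerm_congr {k : ℕ} {c d z c' d' z' a b m n : ℝ} (hc : c = c')
    (h : d * z = d' * z') : randersTerm k c d z a b m n = randersTerm k c' d' z' a b m n := by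
  rw [randersTerm, randersTerm, hc]
  linear_combination diagNorm a b m n / (a * m ^ 2 + b * n ^ 2) ^ k * h

end RandersTerm

section Coefficients

/-- The factor `1 + (1 - ε²) r²` in the denominator of the navigation metric. -/
noncomputable def navDen (ε r : ℝ) : ℝ := 1 + (1 - ε ^ 2) * r ^ 2

/-- The coefficient of `μ²` under the square root. -/
noncomputable def navA (ε r : ℝ) : ℝ := navDen ε r / (1 + r ^ 2)

/-- The coefficient of `ν²` under the square root. -/
noncomputable def navB (r : ℝ) : ℝ := r ^ 2 * (1 + r ^ 2)

/-- The coefficient of `μ²` in the square of the metric. -/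
noncomputable def sqCoeffA (ε r : ℝ) : ℝ := 1 / ((1 + r ^ 2) * navDen ε r)

/-- The coefficient of `ν²` in the square of the metric. -/
noncomputable def sqCoeffB (ε r : ℝ) : ℝ :=
  r ^ 2 * (1 + (1 + ε ^ 2) * r ^ 2) / navDen ε r ^ 2

/-- Half the coefficient of the mixed term in the square of the metric. -/
noncomputable def sqCoeffMixed (ε r : ℝ) : ℝ := -(ε * r ^ 2) / navDen ε r ^ 2

/-- The coefficient of `μ²` in the radial spray coefficient. -/
noncomputable def sprayRadA (ε r : ℝ) : ℝ :=
  -(r * (2 * navDen ε r + ε ^ 2)) / (2 * ((1 + r ^ 2) * navDen ε r))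

/-- The coefficient of `ν²` in the radial spray coefficient. -/
noncomputable def sprayRadB (ε r : ℝ) : ℝ :=
  -(r * (1 + r ^ 2) * (1 + (1 + ε ^ 2) * r ^ 2)) / (2 * navDen ε r ^ 2)

/-- The coefficient of the irrational term in the radial spray coefficient. -/
noncomputable def sprayRadMixed (ε r : ℝ) : ℝ := ε * r * (1 + r ^ 2) / navDen ε r ^ 2

/-- The coefficient of `μ ν` in the angular spray coefficient. -/
noncomputable def sprayAng (ε r : ℝ) : ℝ := 1 / (r * navDen ε r)

/-- The coefficient of the irrational term in the angular spray coefficient. -/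
noncomputable def sprayAngMixed (ε r : ℝ) : ℝ := -ε / (r * (1 + r ^ 2) * navDen ε r)

variable {ε r : ℝ}

theorem hasDerivAt_const_add_mul_sq (c : ℝ) :
    HasDerivAt (fun s => 1 + c * s ^ 2) (2 * c * r) r :=
  (((hasDerivAt_pow 2 r).const_mul c).const_add 1).congr_deriv (by norm_num; ring)

theorem hasDerivAt_one_add_sq : HasDerivAt (fun s : ℝ => 1 + s ^ 2) (2 * r) r :=
  ((hasDerivAt_pow 2 r).const_add 1).congr_deriv (by norm_num)

theorem hasDerivAt_sq : HasDerivAt (fun s : ℝ => s ^ 2) (2 * r) r :=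
  (hasDerivAt_pow 2 r).congr_deriv (by norm_num)

theorem hasDerivAt_navDen : HasDerivAt (navDen ε) (2 * (1 - ε ^ 2) * r) r :=
  hasDerivAt_const_add_mul_sq _

theorem hasDerivAt_navDen_sq :
    HasDerivAt (fun s => navDen ε s ^ 2) (4 * (1 - ε ^ 2) * r * navDen ε r) r :=
  (hasDerivAt_navDen.pow 2).congr_deriv (by norm_num; ring)

theorem hasDerivAt_navA : HasDerivAt (navA ε) (-(2 * ε ^ 2 * r) / (1 + r ^ 2) ^ 2) r := by
  have hw : 1 + r ^ 2 ≠ 0 := by positivity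
  refine (hasDerivAt_navDen.div hasDerivAt_one_add_sq hw).congr_deriv ?_
  unfold navDen
  field_simp
  ring

theorem hasDerivAt_navB : HasDerivAt navB (2 * r + 4 * r ^ 3) r :=
  (hasDerivAt_sq.mul hasDerivAt_one_add_sq).congr_deriv (by ring)

theorem hasDerivAt_sqCoeffA (hD : navDen ε r ≠ 0) :
    HasDerivAt (sqCoeffA ε)
      (-(2 * r * navDen ε r + 2 * (1 - ε ^ 2) * r * (1 + r ^ 2))
        / ((1 + r ^ 2) * navDen ε r) ^ 2) r := by
  have hw : 1 + r ^ 2 ≠ 0 := by positivity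
  refine ((hasDerivAt_const r (1 : ℝ)).div (hasDerivAt_one_add_sq.mul hasDerivAt_navDen)
    (mul_ne_zero hw hD)).congr_deriv ?_
  simp only [Pi.mul_apply]
  field_simp
  ring

theorem hasDerivAt_sqCoeffB (hD : navDen ε r ≠ 0) :
    HasDerivAt (sqCoeffB ε)
      (((2 * r + 4 * (1 + ε ^ 2) * r ^ 3) * navDen ε r
        - 4 * (1 - ε ^ 2) * r ^ 3 * (1 + (1 + ε ^ 2) * r ^ 2)) / navDen ε r ^ 3) r := by
  refine ((hasDerivAt_sq.mul (hasDerivAt_const_add_mul_sq (1 + ε ^ 2))).div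
    hasDerivAt_navDen_sq (pow_ne_zero 2 hD)).congr_deriv ?_
  simp only [Pi.mul_apply]
  field_simp
  ring

theorem hasDerivAt_sqCoeffMixed (hD : navDen ε r ≠ 0) :
    HasDerivAt (sqCoeffMixed ε)
      (-(ε * (2 * r * navDen ε r - 4 * (1 - ε ^ 2) * r ^ 3)) / navDen ε r ^ 3) r := by
  refine ((hasDerivAt_sq.const_mul ε).neg.div
    hasDerivAt_navDen_sq (pow_ne_zero 2 hD)).congr_deriv ?_
  simp only [Pi.neg_apply]
  field_simp
  ring

theorem hasDerivAt_sprayRadA (hD : navDen ε r ≠ 0) :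
    HasDerivAt (sprayRadA ε)
      ((-(2 * navDen ε r + ε ^ 2 + 4 * (1 - ε ^ 2) * r ^ 2) * ((1 + r ^ 2) * navDen ε r)
        + 2 * r ^ 2 * (2 * navDen ε r + ε ^ 2) * (navDen ε r + (1 - ε ^ 2) * (1 + r ^ 2)))
        / (2 * ((1 + r ^ 2) * navDen ε r) ^ 2)) r := by
  have hw : 1 + r ^ 2 ≠ 0 := by positivity
  refine (((hasDerivAt_id r).mul ((hasDerivAt_navDen.const_mul 2).add_const (ε ^ 2))).neg.div
    ((hasDerivAt_one_add_sq.mul hasDerivAt_navDen).const_mul 2)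
    (mul_ne_zero two_ne_zero (mul_ne_zero hw hD))).congr_deriv ?_
  simp only [Pi.mul_apply, Pi.neg_apply, id_eq]
  field_simp
  ring

theorem hasDerivAt_mul_one_add_sq :
    HasDerivAt (fun s : ℝ => s * (1 + s ^ 2)) (1 + 3 * r ^ 2) r :=
  ((hasDerivAt_id r).mul hasDerivAt_one_add_sq).congr_deriv (by simp only [id_eq]; ring)

theorem hasDerivAt_sprayRadB (hD : navDen ε r ≠ 0) :
    HasDerivAt (sprayRadB ε)
      ((-((1 + 3 * r ^ 2) * (1 + (1 + ε ^ 2) * r ^ 2)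
          + 2 * (1 + ε ^ 2) * r ^ 2 * (1 + r ^ 2)) * navDen ε r
        + 4 * (1 - ε ^ 2) * r ^ 2 * (1 + r ^ 2) * (1 + (1 + ε ^ 2) * r ^ 2))
        / (2 * navDen ε r ^ 3)) r := by
  refine ((hasDerivAt_mul_one_add_sq.mul (hasDerivAt_const_add_mul_sq (1 + ε ^ 2))).neg.div
    (hasDerivAt_navDen_sq.const_mul 2)
    (mul_ne_zero two_ne_zero (pow_ne_zero 2 hD))).congr_deriv ?_
  simp only [Pi.mul_apply, Pi.neg_apply]
  field_simp
  ring

theorem hasDerivAt_sprayRadMixed (hD : navDen ε r ≠ 0) :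
    HasDerivAt (sprayRadMixed ε)
      (ε * ((1 + 3 * r ^ 2) * navDen ε r - 4 * (1 - ε ^ 2) * r ^ 2 * (1 + r ^ 2))
        / navDen ε r ^ 3) r := by
  have h : sprayRadMixed ε = fun s => ε * (s * (1 + s ^ 2)) / navDen ε s ^ 2 := by
    funext s
    rw [sprayRadMixed, mul_assoc]
  rw [h]
  refine ((hasDerivAt_mul_one_add_sq.const_mul ε).div
    hasDerivAt_navDen_sq (pow_ne_zero 2 hD)).congr_deriv ?_
  field_simp

theorem hasDerivAt_sprayAng (hr : r ≠ 0) (hD : navDen ε r ≠ 0) :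
    HasDerivAt (sprayAng ε)
      (-(navDen ε r + 2 * (1 - ε ^ 2) * r ^ 2) / (r * navDen ε r) ^ 2) r := by
  refine ((hasDerivAt_const r (1 : ℝ)).div ((hasDerivAt_id r).mul hasDerivAt_navDen)
    (mul_ne_zero hr hD)).congr_deriv ?_
  simp only [Pi.mul_apply, id_eq]
  field_simp
  ring

theorem hasDerivAt_sprayAngMixed (hr : r ≠ 0) (hD : navDen ε r ≠ 0) :
    HasDerivAt (sprayAngMixed ε)
      (ε * ((1 + 3 * r ^ 2) * navDen ε r + 2 * (1 - ε ^ 2) * r ^ 2 * (1 + r ^ 2))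
        / (r * (1 + r ^ 2) * navDen ε r) ^ 2) r := by
  have hw : 1 + r ^ 2 ≠ 0 := by positivity
  refine ((hasDerivAt_const r (-ε)).div (hasDerivAt_mul_one_add_sq.mul hasDerivAt_navDen)
    (mul_ne_zero (mul_ne_zero hr hw) hD)).congr_deriv ?_
  simp only [Pi.mul_apply]
  field_simp
  ring

end Coefficients

section NavigationDomain

/-- The domain of the navigation metric, as a set of pairs (point, tangent vector). -/
def navDomain (ε : ℝ) : Set ((Fin 2 → ℝ) × (Fin 2 → ℝ)) :=
  {z | 0 < z.1 0 ∧ 0 < navDen ε (z.1 0) ∧ z.2 ≠ 0}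

variable {ε : ℝ}

theorem isOpen_navDomain : IsOpen (navDomain ε) := by
  have h0 : Continuous fun z : (Fin 2 → ℝ) × (Fin 2 → ℝ) => z.1 0 := by fun_prop
  have h1 : Continuous fun z : (Fin 2 → ℝ) × (Fin 2 → ℝ) => navDen ε (z.1 0) := by
    unfold navDen
    fun_prop
  exact (isOpen_lt continuous_const h0).inter
    ((isOpen_lt continuous_const h1).inter (isOpen_ne_fun continuous_snd continuous_const))

theorem navForm_pos {x y : Fin 2 → ℝ} (h : (x, y) ∈ navDomain ε) :
    0 < navA ε (x 0) * y 0 ^ 2 + navB (x 0) * y 1 ^ 2 := by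
  obtain ⟨hr, hD, hy⟩ := h
  have ha : 0 < navA ε (x 0) := div_pos hD (by positivity)
  have hb : 0 < navB (x 0) := by
    have : 0 < x 0 := hr
    unfold navB
    positivity
  by_cases h0 : y 0 = 0
  · have h1 : y 1 ≠ 0 := fun h1 => hy (by ext i; fin_cases i <;> simpa)
    positivity
  · positivity

theorem hasDerivAt_of_cubic {f : ℝ → ℝ} {f' t : ℝ} (c₀ c₁ c₂ c₃ : ℝ)
    (hf : ∀ s, f s = c₀ + c₁ * s + c₂ * s ^ 2 + c₃ * s ^ 3)
    (hf' : f' = c₁ + 2 * c₂ * t + 3 * c₃ * t ^ 2) : HasDerivAt f f' t := by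
  rw [funext hf, hf']
  refine (((((hasDerivAt_id t).const_mul c₁).const_add c₀).add
    ((hasDerivAt_pow 2 t).const_mul c₂)).add ((hasDerivAt_pow 3 t).const_mul c₃)).congr_deriv ?_
  norm_num
  ring

/-- `f` agrees on the domain with a `randersTerm` in the coefficients of the navigation metric. -/
def IsNavTerm (ε : ℝ) (f : (Fin 2 → ℝ) → (Fin 2 → ℝ) → ℝ) (k : ℕ) (c : ℝ → ℝ → ℝ → ℝ)
    (d : ℝ → ℝ) (z : ℝ → ℝ → ℝ → ℝ) : Prop :=
  ∀ x y, (x, y) ∈ navDomain ε → f x y =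
    randersTerm k (c (x 0) (y 0) (y 1)) (d (x 0)) (z (x 0) (y 0) (y 1))
      (navA ε (x 0)) (navB (x 0)) (y 0) (y 1)

variable {f : (Fin 2 → ℝ) → (Fin 2 → ℝ) → ℝ} {k : ℕ} {c z c' z' w : ℝ → ℝ → ℝ → ℝ} {d : ℝ → ℝ}

theorem IsNavTerm.const_mul (hf : IsNavTerm ε f k c d z) (q : ℝ) :
    IsNavTerm ε (fun x y => q * f x y) k (fun r m n => q * c r m n) (fun r => q * d r) z := by
  intro x y h
  change q * f x y = _
  rw [hf x y h]
  simp only [randersTerm]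
  ring

theorem IsNavTerm.congr {d' : ℝ → ℝ} (hf : IsNavTerm ε f k c d z)
    (hc : ∀ r m n, c r m n = c' r m n) (h : ∀ r m n, d r * z r m n = d' r * z' r m n) :
    IsNavTerm ε f k c' d' z' :=
  fun x y hxy => (hf x y hxy).trans (randersTerm_congr (hc _ _ _) (h _ _ _))

theorem IsNavTerm.pdy_zero (hf : IsNavTerm ε f k c d z)
    (hc : ∀ r m n, HasDerivAt (fun s => c r s n) (c' r m n) m)
    (hz : ∀ r m n, HasDerivAt (fun s => z r s n) (z' r m n) m)
    (hw : ∀ r m n, z' r m n * (navA ε r * m ^ 2 + navB r * n ^ 2)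
      + (1 / 2 - k) * z r m n * (2 * navA ε r * m) = w r m n) :
    IsNavTerm ε (pdy 0 f) (k + 1) c' d w := by
  intro x y h
  refine pdy_zero_eq (φ := fun r m n => randersTerm k (c r m n) (d r) (z r m n)
    (navA ε r) (navB r) m n) isOpen_navDomain hf h ?_
  refine (hasDerivAt_randersTerm (α := fun _ => navA ε (x 0)) (β := fun _ => navB (x 0))
    (μ := fun s => s) (ν := fun _ => y 1) (d := fun _ => d (x 0)) k (navForm_pos h)
    hasDerivAt_diagForm_left (hc _ _ _) (hasDerivAt_const _ _) (hz _ _ _)).congr_deriv ?_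
  refine randersTerm_congr rfl ?_
  rw [← hw]
  ring

theorem IsNavTerm.pdy_one (hf : IsNavTerm ε f k c d z)
    (hc : ∀ r m n, HasDerivAt (fun s => c r m s) (c' r m n) n)
    (hz : ∀ r m n, HasDerivAt (fun s => z r m s) (z' r m n) n)
    (hw : ∀ r m n, z' r m n * (navA ε r * m ^ 2 + navB r * n ^ 2)
      + (1 / 2 - k) * z r m n * (2 * navB r * n) = w r m n) :
    IsNavTerm ε (pdy 1 f) (k + 1) c' d w := by
  intro x y h
  refine pdy_one_eq (φ := fun r m n => randersTerm k (c r m n) (d r) (z r m n)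
    (navA ε r) (navB r) m n) isOpen_navDomain hf h ?_
  refine (hasDerivAt_randersTerm (α := fun _ => navA ε (x 0)) (β := fun _ => navB (x 0))
    (μ := fun _ => y 0) (ν := fun s => s) (d := fun _ => d (x 0)) k (navForm_pos h)
    hasDerivAt_diagForm_right (hc _ _ _) (hasDerivAt_const _ _) (hz _ _ _)).congr_deriv ?_
  refine randersTerm_congr rfl ?_
  rw [← hw]
  ring

theorem IsNavTerm.pdx_zero (hf : IsNavTerm ε f k c d z) {x y : Fin 2 → ℝ}
    (h : (x, y) ∈ navDomain ε) {c' d' z' : ℝ}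
    (hc : HasDerivAt (fun s => c s (y 0) (y 1)) c' (x 0)) (hd : HasDerivAt d d' (x 0))
    (hz : HasDerivAt (fun s => z s (y 0) (y 1)) z' (x 0)) :
    pdx 0 f x y = randersTerm (k + 1) c' 1
      (d' * z (x 0) (y 0) (y 1) * (navA ε (x 0) * y 0 ^ 2 + navB (x 0) * y 1 ^ 2)
        + d (x 0) * (z' * (navA ε (x 0) * y 0 ^ 2 + navB (x 0) * y 1 ^ 2)
          + (1 / 2 - k) * z (x 0) (y 0) (y 1)
            * (-(2 * ε ^ 2 * x 0) / (1 + x 0 ^ 2) ^ 2 * y 0 ^ 2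
              + (2 * x 0 + 4 * x 0 ^ 3) * y 1 ^ 2)))
      (navA ε (x 0)) (navB (x 0)) (y 0) (y 1) := by
  refine pdx_zero_eq (φ := fun r m n => randersTerm k (c r m n) (d r) (z r m n)
    (navA ε r) (navB r) m n) isOpen_navDomain hf h ?_
  exact hasDerivAt_randersTerm (μ := fun _ => y 0) (ν := fun _ => y 1) k (navForm_pos h)
    (hasDerivAt_diagForm_coeff hasDerivAt_navA hasDerivAt_navB) hc hd hz

theorem IsNavTerm.pdx_one (hf : IsNavTerm ε f k c d z) {x y : Fin 2 → ℝ}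
    (h : (x, y) ∈ navDomain ε) : pdx 1 f x y = 0 :=
  pdx_one_eq (φ := fun r m n => randersTerm k (c r m n) (d r) (z r m n)
    (navA ε r) (navB r) m n) isOpen_navDomain hf h

end NavigationDomain

section NavigationMetric

/-- The navigation metric on the round sphere with rotation field of parameter `ε`. -/
noncomputable def navMetric (ε : ℝ) (x y : Fin 2 → ℝ) : ℝ :=
  (√((1 + (1 - ε ^ 2) * (x 0) ^ 2) * (y 0) ^ 2
        + (x 0) ^ 2 * (1 + (x 0) ^ 2) ^ 2 * (y 1) ^ 2) / √(1 + (x 0) ^ 2)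
      - ε * (x 0) ^ 2 * y 1) / (1 + (1 - ε ^ 2) * (x 0) ^ 2)

variable {ε : ℝ}

theorem navMetric_eq (x y : Fin 2 → ℝ) :
    navMetric ε x y = (diagNorm (navA ε (x 0)) (navB (x 0)) (y 0) (y 1)
      - ε * x 0 ^ 2 * y 1) / navDen ε (x 0) := by
  have hw : 0 < 1 + x 0 ^ 2 := by positivity
  unfold navMetric diagNorm navA navB navDen
  rw [← Real.sqrt_div' _ hw.le]
  congr 4
  field_simp

theorem isNavTerm_navMetric : IsNavTerm ε (navMetric ε) 0
    (fun r _ n => -(ε * r ^ 2 * n) / navDen ε r) (fun r => 1 / navDen ε r) (fun _ _ _ => 1) := by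
  intro x y h
  rw [navMetric_eq]
  simp only [randersTerm]
  ring

theorem isNavTerm_navMetric_sq : IsNavTerm ε (fun x y => navMetric ε x y ^ 2) 0
    (fun r m n => sqCoeffA ε r * m ^ 2 + sqCoeffB ε r * n ^ 2) (fun r => 2 * sqCoeffMixed ε r)
    (fun _ _ n => n) := by
  intro x y h
  have hA := diagNorm_sq (navForm_pos h)
  have hw : 1 + x 0 ^ 2 ≠ 0 := by positivity
  have hD : navDen ε (x 0) ≠ 0 := h.2.1.ne'
  simp only [navMetric_eq, randersTerm, pow_zero, div_one]
  generalize diagNorm (navA ε (x 0)) (navB (x 0)) (y 0) (y 1) = A at hA ⊢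
  rw [div_pow, sub_sq, hA]
  unfold navA navB sqCoeffA sqCoeffB sqCoeffMixed
  field_simp
  ring

theorem isNavTerm_pdy_zero_sq : IsNavTerm ε (pdy 0 fun x y => navMetric ε x y ^ 2) 1
    (fun r m _ => 2 * sqCoeffA ε r * m) (fun r => 2 * sqCoeffMixed ε r)
    (fun r m n => navA ε r * m * n) :=
  isNavTerm_navMetric_sq.pdy_zero (z' := fun _ _ _ => 0)
    (fun r m n => hasDerivAt_of_cubic (sqCoeffB ε r * n ^ 2) 0 (sqCoeffA ε r) 0
      (fun s => by ring) (by ring))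
    (fun r m n => hasDerivAt_const _ _) (fun r m n => by norm_num; ring)

theorem isNavTerm_pdy_one_sq : IsNavTerm ε (pdy 1 fun x y => navMetric ε x y ^ 2) 1
    (fun r _ n => 2 * sqCoeffB ε r * n) (fun r => 2 * sqCoeffMixed ε r)
    (fun r m n => navA ε r * m ^ 2 + 2 * navB r * n ^ 2) :=
  isNavTerm_navMetric_sq.pdy_one (z' := fun _ _ _ => 1)
    (fun r m n => hasDerivAt_of_cubic (sqCoeffA ε r * m ^ 2) 0 (sqCoeffB ε r) 0
      (fun s => by ring) (by ring))
    (fun r m n => hasDerivAt_id' _) (fun r m n => by norm_num; ring)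

theorem isNavTerm_fundTensor_zero_zero : IsNavTerm ε (fundTensor (navMetric ε) 0 0) 2
    (fun r _ _ => sqCoeffA ε r) (sqCoeffMixed ε) (fun r _ n => navA ε r * navB r * n ^ 3) := by
  refine ((isNavTerm_pdy_zero_sq.pdy_zero (c' := fun r _ _ => 2 * sqCoeffA ε r)
    (z' := fun r _ n => navA ε r * n) (w := fun r _ n => navA ε r * navB r * n ^ 3)
    (fun r m n => hasDerivAt_of_cubic 0 (2 * sqCoeffA ε r) 0 0 (fun s => by ring) (by ring))
    (fun r m n => hasDerivAt_of_cubic 0 (navA ε r * n) 0 0 (fun s => by ring) (by ring))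
    (fun r m n => by norm_num; ring)).const_mul (1 / 2)).congr ?_ ?_ <;> intros <;> ring

theorem isNavTerm_fundTensor_zero_one : IsNavTerm ε (fundTensor (navMetric ε) 0 1) 2
    (fun _ _ _ => 0) (sqCoeffMixed ε) (fun r m _ => navA ε r ^ 2 * m ^ 3) := by
  refine ((isNavTerm_pdy_one_sq.pdy_zero (c' := fun _ _ _ => 0)
    (z' := fun r m _ => 2 * navA ε r * m) (w := fun r m _ => navA ε r ^ 2 * m ^ 3)
    (fun r m n => hasDerivAt_const _ _)
    (fun r m n => hasDerivAt_of_cubic (2 * navB r * n ^ 2) 0 (navA ε r) 0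
      (fun s => by ring) (by ring))
    (fun r m n => by norm_num; ring)).const_mul (1 / 2)).congr ?_ ?_ <;> intros <;> ring

theorem isNavTerm_fundTensor_one_zero : IsNavTerm ε (fundTensor (navMetric ε) 1 0) 2
    (fun _ _ _ => 0) (sqCoeffMixed ε) (fun r m _ => navA ε r ^ 2 * m ^ 3) := by
  refine ((isNavTerm_pdy_zero_sq.pdy_one (c' := fun _ _ _ => 0)
    (z' := fun r m _ => navA ε r * m) (w := fun r m _ => navA ε r ^ 2 * m ^ 3)
    (fun r m n => hasDerivAt_const _ _)
    (fun r m n => hasDerivAt_of_cubic 0 (navA ε r * m) 0 0 (fun s => by ring) (by ring))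
    (fun r m n => by norm_num; ring)).const_mul (1 / 2)).congr ?_ ?_ <;> intros <;> ring

theorem isNavTerm_fundTensor_one_one : IsNavTerm ε (fundTensor (navMetric ε) 1 1) 2
    (fun r _ _ => sqCoeffB ε r) (sqCoeffMixed ε)
    (fun r m n => navB r * n * (3 * navA ε r * m ^ 2 + 2 * navB r * n ^ 2)) := by
  refine ((isNavTerm_pdy_one_sq.pdy_one (c' := fun r _ _ => 2 * sqCoeffB ε r)
    (z' := fun r _ n => 4 * navB r * n)
    (w := fun r m n => navB r * n * (3 * navA ε r * m ^ 2 + 2 * navB r * n ^ 2))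
    (fun r m n => hasDerivAt_of_cubic 0 (2 * sqCoeffB ε r) 0 0 (fun s => by ring) (by ring))
    (fun r m n => hasDerivAt_of_cubic (navA ε r * m ^ 2) 0 (2 * navB r) 0
      (fun s => by ring) (by ring))
    (fun r m n => by norm_num; ring)).const_mul (1 / 2)).congr ?_ ?_ <;> intros <;> ring

end NavigationMetric

section NavigationPositivity

variable {ε r : ℝ} {x y : Fin 2 → ℝ}

theorem navMetric_pos (h : (x, y) ∈ navDomain ε) : 0 < navMetric ε x y := by
  have hw : 1 + x 0 ^ 2 ≠ 0 := by positivity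
  have hP := navForm_pos h
  have hN := diagNorm_pos hP
  have hN2 := diagNorm_sq hP
  obtain ⟨hr, hD, hy⟩ := h
  replace hr : 0 < x 0 := hr
  replace hD : 0 < navDen ε (x 0) := hD
  rw [navMetric_eq]
  refine div_pos (sub_pos.2 (lt_of_pow_lt_pow_left₀ 2 hN.le ?_)) hD
  rw [hN2, ← sub_pos]
  have key : navA ε (x 0) * y 0 ^ 2 + navB (x 0) * y 1 ^ 2 - (ε * x 0 ^ 2 * y 1) ^ 2
      = navDen ε (x 0) * (y 0 ^ 2 / (1 + x 0 ^ 2) + (x 0 * y 1) ^ 2) := by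
    unfold navA navB navDen
    field_simp
    ring
  rw [key]
  refine mul_pos hD ?_
  by_cases h0 : y 0 = 0
  · have h1 : y 1 ≠ 0 := fun h1 => hy (by ext i; fin_cases i <;> simpa)
    positivity
  · positivity

theorem navMetric_eq_randers (x y : Fin 2 → ℝ) :
    navMetric ε x y = diagNorm (navA ε (x 0)) (navB (x 0)) (y 0) (y 1) * (1 / navDen ε (x 0))
      + -(ε * x 0 ^ 2) / navDen ε (x 0) * y 1 := by
  rw [navMetric_eq]
  ring

theorem pdy_zero_navMetric (h : (x, y) ∈ navDomain ε) :
    pdy 0 (navMetric ε) x y = diagNorm (navA ε (x 0)) (navB (x 0)) (y 0) (y 1)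
      * (navA ε (x 0) * y 0 / (navA ε (x 0) * y 0 ^ 2 + navB (x 0) * y 1 ^ 2))
      * (1 / navDen ε (x 0)) := by
  refine ((isNavTerm_navMetric.pdy_zero (c' := fun _ _ _ => 0) (z' := fun _ _ _ => 0)
    (w := fun r m _ => navA ε r * m) (fun r m n => hasDerivAt_const _ _)
    (fun r m n => hasDerivAt_const _ _) (fun r m n => by norm_num; ring)) x y h).trans ?_
  simp only [randersTerm]
  ring

theorem pdy_one_navMetric (h : (x, y) ∈ navDomain ε) :
    pdy 1 (navMetric ε) x y = diagNorm (navA ε (x 0)) (navB (x 0)) (y 0) (y 1)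
      * (navB (x 0) * y 1 / (navA ε (x 0) * y 0 ^ 2 + navB (x 0) * y 1 ^ 2))
      * (1 / navDen ε (x 0)) + -(ε * x 0 ^ 2) / navDen ε (x 0) := by
  refine ((isNavTerm_navMetric.pdy_one (c' := fun r _ _ => -(ε * r ^ 2) / navDen ε r)
    (z' := fun _ _ _ => 0) (w := fun r _ n => navB r * n)
    (fun r m n => hasDerivAt_of_cubic 0 (-(ε * r ^ 2) / navDen ε r) 0 0
      (fun s => by ring) (by ring))
    (fun r m n => hasDerivAt_const _ _) (fun r m n => by norm_num; ring)) x y h).trans ?_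
  simp only [randersTerm]
  ring

/-- The Euler identity for the navigation metric. -/
theorem navMetric_euler (h : (x, y) ∈ navDomain ε) :
    navMetric ε x y = y 0 * pdy 0 (navMetric ε) x y + y 1 * pdy 1 (navMetric ε) x y := by
  have hA := diagNorm_sq (navForm_pos h)
  have hA0 := (diagNorm_pos (navForm_pos h)).ne'
  rw [pdy_zero_navMetric h, pdy_one_navMetric h, navMetric_eq_randers, ← hA]
  generalize 1 / navDen ε (x 0) = k
  generalize -(ε * x 0 ^ 2) / navDen ε (x 0) = β
  generalize diagNorm (navA ε (x 0)) (navB (x 0)) (y 0) (y 1) = A at hA hA0 ⊢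
  field_simp
  linear_combination k * hA

theorem sqCoeffA_eq : sqCoeffA ε r = (1 / navDen ε r) ^ 2 * navA ε r := by
  unfold sqCoeffA navA
  by_cases hD : navDen ε r = 0
  · simp [hD]
  · field_simp

theorem sqCoeffB_eq (hD : navDen ε r ≠ 0) : sqCoeffB ε r
    = (1 / navDen ε r) ^ 2 * navB r + (-(ε * r ^ 2) / navDen ε r) ^ 2 := by
  unfold sqCoeffB navB
  field_simp
  ring

theorem sqCoeffMixed_eq : sqCoeffMixed ε r
    = 1 / navDen ε r * (-(ε * r ^ 2) / navDen ε r) := by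
  unfold sqCoeffMixed
  ring

/-- The factor of the angular part of the fundamental tensor. -/
noncomputable def angularFactor (ε : ℝ) (x y : Fin 2 → ℝ) : ℝ :=
  navMetric ε x y * (diagNorm (navA ε (x 0)) (navB (x 0)) (y 0) (y 1)
    * (1 / navDen ε (x 0) * (navA ε (x 0) * navB (x 0))
      / (navA ε (x 0) * y 0 ^ 2 + navB (x 0) * y 1 ^ 2) ^ 2))

theorem angularFactor_pos (h : (x, y) ∈ navDomain ε) : 0 < angularFactor ε x y := by
  have hr : 0 < x 0 := h.1
  have hD : 0 < navDen ε (x 0) := h.2.1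
  have hP := navForm_pos h
  have hN := diagNorm_pos hP
  have hF := navMetric_pos h
  have ha : 0 < navA ε (x 0) := div_pos hD (by positivity)
  have hb : 0 < navB (x 0) := by
    unfold navB
    positivity
  unfold angularFactor
  positivity

theorem fundTensor_navMetric_zero_zero (h : (x, y) ∈ navDomain ε) :
    fundTensor (navMetric ε) 0 0 x y
      = pdy 0 (navMetric ε) x y ^ 2 + angularFactor ε x y * y 1 ^ 2 := by
  have hA := diagNorm_sq (navForm_pos h)
  have hA0 := (diagNorm_pos (navForm_pos h)).ne'
  refine (isNavTerm_fundTensor_zero_zero x y h).trans ?_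
  beta_reduce
  rw [pdy_zero_navMetric h, angularFactor, navMetric_eq_randers, sqCoeffA_eq, sqCoeffMixed_eq,
    randersTerm, ← hA]
  generalize 1 / navDen ε (x 0) = k
  generalize -(ε * x 0 ^ 2) / navDen ε (x 0) = β
  generalize diagNorm (navA ε (x 0)) (navB (x 0)) (y 0) (y 1) = A at hA hA0 ⊢
  field_simp
  linear_combination k ^ 2 * navA ε (x 0) * A * hA

theorem fundTensor_navMetric_zero_one (h : (x, y) ∈ navDomain ε) :
    fundTensor (navMetric ε) 0 1 x y = pdy 0 (navMetric ε) x y * pdy 1 (navMetric ε) x y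
      - angularFactor ε x y * (y 0 * y 1) := by
  have hA := diagNorm_sq (navForm_pos h)
  have hA0 := (diagNorm_pos (navForm_pos h)).ne'
  refine (isNavTerm_fundTensor_zero_one x y h).trans ?_
  beta_reduce
  rw [pdy_zero_navMetric h, pdy_one_navMetric h, angularFactor, navMetric_eq_randers,
    sqCoeffMixed_eq, randersTerm, ← hA]
  generalize 1 / navDen ε (x 0) = k
  generalize -(ε * x 0 ^ 2) / navDen ε (x 0) = β
  generalize diagNorm (navA ε (x 0)) (navB (x 0)) (y 0) (y 1) = A at hA hA0 ⊢
  field_simp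
  linear_combination -(k * β * navA ε (x 0) * y 0) * hA

theorem fundTensor_navMetric_one_zero (h : (x, y) ∈ navDomain ε) :
    fundTensor (navMetric ε) 1 0 x y = fundTensor (navMetric ε) 0 1 x y :=
  (isNavTerm_fundTensor_one_zero x y h).trans (isNavTerm_fundTensor_zero_one x y h).symm

theorem fundTensor_navMetric_one_one (h : (x, y) ∈ navDomain ε) :
    fundTensor (navMetric ε) 1 1 x y
      = pdy 1 (navMetric ε) x y ^ 2 + angularFactor ε x y * y 0 ^ 2 := by
  have hA := diagNorm_sq (navForm_pos h)
  have hA0 := (diagNorm_pos (navForm_pos h)).ne'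
  refine (isNavTerm_fundTensor_one_one x y h).trans ?_
  beta_reduce
  rw [pdy_one_navMetric h, angularFactor, navMetric_eq_randers,
    sqCoeffB_eq (ne_of_gt h.2.1 : navDen ε (x 0) ≠ 0),
    sqCoeffMixed_eq, randersTerm, ← hA]
  generalize 1 / navDen ε (x 0) = k
  generalize -(ε * x 0 ^ 2) / navDen ε (x 0) = β
  generalize diagNorm (navA ε (x 0)) (navB (x 0)) (y 0) (y 1) = A at hA hA0 ⊢
  field_simp
  linear_combination (k ^ 2 * navB (x 0) * A - 2 * k * β * navB (x 0) * y 1) * hA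

theorem posDef_fundMatrix_navMetric (h : (x, y) ∈ navDomain ε) :
    (fundMatrix (navMetric ε) x y).PosDef := by
  refine Matrix.PosDef.of_dotProduct_mulVec_pos ?_ fun v hv => ?_
  · ext i j
    fin_cases i <;> fin_cases j <;> simp [fundMatrix, fundTensor_navMetric_one_zero h]
  · have hF := navMetric_pos h
    have hκ := angularFactor_pos h
    have hE := navMetric_euler h
    have key : star v ⬝ᵥ Matrix.mulVec (fundMatrix (navMetric ε) x y) v
        = (pdy 0 (navMetric ε) x y * v 0 + pdy 1 (navMetric ε) x y * v 1) ^ 2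
          + angularFactor ε x y * (y 1 * v 0 - y 0 * v 1) ^ 2 := by
      simp only [dotProduct, Matrix.mulVec, Fin.sum_univ_two, fundMatrix, Matrix.of_apply,
        star_trivial, fundTensor_navMetric_zero_zero h, fundTensor_navMetric_zero_one h,
        fundTensor_navMetric_one_zero h, fundTensor_navMetric_one_one h]
      ring
    rw [key]
    generalize pdy 0 (navMetric ε) x y = p at *
    generalize pdy 1 (navMetric ε) x y = q at *
    by_cases h1 : y 1 * v 0 - y 0 * v 1 = 0
    · have h2 : p * v 0 + q * v 1 ≠ 0 := by
        intro h2
        have e0 : navMetric ε x y * v 0 = 0 := by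
          rw [hE]
          linear_combination y 0 * h2 + q * h1
        have e1 : navMetric ε x y * v 1 = 0 := by
          rw [hE]
          linear_combination y 1 * h2 - p * h1
        have v0 := (mul_eq_zero.1 e0).resolve_left hF.ne'
        have v1 := (mul_eq_zero.1 e1).resolve_left hF.ne'
        exact hv (by ext i; fin_cases i <;> simpa)
      positivity
    · positivity

end NavigationPositivity

section NavigationSpray

variable {ε : ℝ} {x y : Fin 2 → ℝ}

/-- The radial spray coefficient of the navigation metric. -/
noncomputable def navSprayRad (ε : ℝ) (x y : Fin 2 → ℝ) : ℝ :=
  randersTerm 0 (sprayRadA ε (x 0) * y 0 ^ 2 + sprayRadB ε (x 0) * y 1 ^ 2)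
    (sprayRadMixed ε (x 0)) (y 1) (navA ε (x 0)) (navB (x 0)) (y 0) (y 1)

/-- The angular spray coefficient of the navigation metric. -/
noncomputable def navSprayAng (ε : ℝ) (x y : Fin 2 → ℝ) : ℝ :=
  randersTerm 0 (sprayAng ε (x 0) * y 0 * y 1)
    (sprayAngMixed ε (x 0)) (y 0) (navA ε (x 0)) (navB (x 0)) (y 0) (y 1)

theorem navA_form_eq (r m n : ℝ) : navDen ε r / (1 + r ^ 2) * m ^ 2 + r ^ 2 * (1 + r ^ 2) * n ^ 2
    = (navDen ε r * m ^ 2 + r ^ 2 * (1 + r ^ 2) ^ 2 * n ^ 2) / (1 + r ^ 2) := by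
  have hw : 1 + r ^ 2 ≠ 0 := by positivity
  field_simp

theorem navForm_num_pos (h : (x, y) ∈ navDomain ε) :
    0 < navDen ε (x 0) * y 0 ^ 2 + x 0 ^ 2 * (1 + x 0 ^ 2) ^ 2 * y 1 ^ 2 := by
  have hP := navForm_pos h
  have hw : 0 < 1 + x 0 ^ 2 := by positivity
  rw [navA, navB, navA_form_eq] at hP
  exact (div_pos_iff_of_pos_right hw).1 hP

theorem eq_of_sq_eq_of_sub_eq {A P L R : ℝ} (S : ℝ) (hA : A ^ 2 = P)
    (h : L - R = S * (A ^ 2 - P)) : L = R := by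
  rw [hA, sub_self, mul_zero] at h
  exact sub_eq_zero.1 h

set_option maxRecDepth 100000 in
set_option maxHeartbeats 4000000 in
theorem spray_lowered_zero (h : (x, y) ∈ navDomain ε) :
    (1 / 4) * ∑ p, ∑ q, (2 * pdx q (fundTensor (navMetric ε) p 0) x y
        - pdx 0 (fundTensor (navMetric ε) p q) x y) * y p * y q
      = fundTensor (navMetric ε) 0 0 x y * navSprayRad ε x y
        + fundTensor (navMetric ε) 0 1 x y * navSprayAng ε x y := by
  have hr : x 0 ≠ 0 := ne_of_gt h.1
  have hD : navDen ε (x 0) ≠ 0 := ne_of_gt h.2.1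
  have hw : 1 + x 0 ^ 2 ≠ 0 := by positivity
  have hT := (navForm_num_pos h).ne'
  have hA := diagNorm_sq (navForm_pos h)
  simp only [Fin.sum_univ_two, isNavTerm_fundTensor_zero_zero.pdx_one h,
    isNavTerm_fundTensor_one_zero.pdx_one h]
  rw [isNavTerm_fundTensor_zero_zero.pdx_zero h (hasDerivAt_sqCoeffA hD)
      (hasDerivAt_sqCoeffMixed hD) ((hasDerivAt_navA.mul hasDerivAt_navB).mul_const _),
    isNavTerm_fundTensor_zero_one.pdx_zero h (hasDerivAt_const _ _)
      (hasDerivAt_sqCoeffMixed hD) ((hasDerivAt_navA.pow 2).mul_const _),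
    isNavTerm_fundTensor_one_zero.pdx_zero h (hasDerivAt_const _ _)
      (hasDerivAt_sqCoeffMixed hD) ((hasDerivAt_navA.pow 2).mul_const _),
    isNavTerm_fundTensor_one_one.pdx_zero h (hasDerivAt_sqCoeffB hD)
      (hasDerivAt_sqCoeffMixed hD) ((hasDerivAt_navB.mul_const _).mul
        (((hasDerivAt_navA.const_mul 3).mul_const _).add
          ((hasDerivAt_navB.const_mul 2).mul_const _))),
    isNavTerm_fundTensor_zero_zero x y h, isNavTerm_fundTensor_zero_one x y h]
  simp only [randersTerm, navSprayRad, navSprayAng]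
  generalize diagNorm (navA ε (x 0)) (navB (x 0)) (y 0) (y 1) = A at hA ⊢
  refine eq_of_sq_eq_of_sub_eq (-(sqCoeffMixed ε (x 0) *
    (navA ε (x 0) * navB (x 0) * y 1 ^ 4 * sprayRadMixed ε (x 0)
      + navA ε (x 0) ^ 2 * y 0 ^ 4 * sprayAngMixed ε (x 0))
    / (navA ε (x 0) * y 0 ^ 2 + navB (x 0) * y 1 ^ 2) ^ 2)) hA ?_
  clear hA
  simp only [sqCoeffA, sqCoeffMixed, sprayRadA, sprayRadB, sprayRadMixed, sprayAng,
    sprayAngMixed, navA, navB, navA_form_eq, Nat.cast_ofNat, Nat.reduceSub, Nat.reduceAdd,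
    pow_one, pow_zero, div_one]
  generalize y 0 = m at *
  generalize y 1 = n at *
  generalize x 0 = r at *
  generalize hDr : navDen ε r = D at *
  generalize hwr : 1 + r ^ 2 = w at *
  generalize hTr : D * m ^ 2 + r ^ 2 * w ^ 2 * n ^ 2 = T at *
  clear h
  field_simp
  simp only [← hTr, ← hwr, ← hDr, navDen]
  ring

set_option maxRecDepth 100000 in
set_option maxHeartbeats 4000000 in
theorem spray_lowered_one (h : (x, y) ∈ navDomain ε) :
    (1 / 4) * ∑ p, ∑ q, (2 * pdx q (fundTensor (navMetric ε) p 1) x y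
        - pdx 1 (fundTensor (navMetric ε) p q) x y) * y p * y q
      = fundTensor (navMetric ε) 1 0 x y * navSprayRad ε x y
        + fundTensor (navMetric ε) 1 1 x y * navSprayAng ε x y := by
  have hr : x 0 ≠ 0 := ne_of_gt h.1
  have hD : navDen ε (x 0) ≠ 0 := ne_of_gt h.2.1
  have hw : 1 + x 0 ^ 2 ≠ 0 := by positivity
  have hT := (navForm_num_pos h).ne'
  have hA := diagNorm_sq (navForm_pos h)
  simp only [Fin.sum_univ_two, isNavTerm_fundTensor_zero_zero.pdx_one h,
    isNavTerm_fundTensor_zero_one.pdx_one h, isNavTerm_fundTensor_one_zero.pdx_one h,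
    isNavTerm_fundTensor_one_one.pdx_one h]
  rw [isNavTerm_fundTensor_zero_one.pdx_zero h (hasDerivAt_const _ _)
      (hasDerivAt_sqCoeffMixed hD) ((hasDerivAt_navA.pow 2).mul_const _),
    isNavTerm_fundTensor_one_one.pdx_zero h (hasDerivAt_sqCoeffB hD)
      (hasDerivAt_sqCoeffMixed hD) ((hasDerivAt_navB.mul_const _).mul
        (((hasDerivAt_navA.const_mul 3).mul_const _).add
          ((hasDerivAt_navB.const_mul 2).mul_const _))),
    isNavTerm_fundTensor_one_zero x y h, isNavTerm_fundTensor_one_one x y h]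
  simp only [randersTerm, navSprayRad, navSprayAng]
  generalize diagNorm (navA ε (x 0)) (navB (x 0)) (y 0) (y 1) = A at hA ⊢
  refine eq_of_sq_eq_of_sub_eq (-(sqCoeffMixed ε (x 0) *
    (navA ε (x 0) ^ 2 * y 0 ^ 3 * y 1 * sprayRadMixed ε (x 0)
      + navB (x 0) * y 1 * (3 * navA ε (x 0) * y 0 ^ 2 + 2 * navB (x 0) * y 1 ^ 2) * y 0
        * sprayAngMixed ε (x 0))
    / (navA ε (x 0) * y 0 ^ 2 + navB (x 0) * y 1 ^ 2) ^ 2)) hA ?_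
  clear hA
  simp only [sqCoeffB, sqCoeffMixed, sprayRadA, sprayRadB, sprayRadMixed, sprayAng,
    sprayAngMixed, navA, navB, navA_form_eq, Nat.cast_ofNat, Nat.reduceSub, Nat.reduceAdd,
    pow_one, pow_zero, div_one]
  generalize y 0 = m at *
  generalize y 1 = n at *
  generalize x 0 = r at *
  generalize hDr : navDen ε r = D at *
  generalize hwr : 1 + r ^ 2 = w at *
  generalize hTr : D * m ^ 2 + r ^ 2 * w ^ 2 * n ^ 2 = T at *
  clear h
  field_simp
  simp only [← hTr, ← hwr, ← hDr, navDen]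
  ring

theorem lowered_spray_eq (h : (x, y) ∈ navDomain ε) (k : Fin 2) :
    (1 / 4) * ∑ p, ∑ q, (2 * pdx q (fundTensor (navMetric ε) p k) x y
        - pdx k (fundTensor (navMetric ε) p q) x y) * y p * y q
      = Matrix.mulVec (fundMatrix (navMetric ε) x y)
          ![navSprayRad ε x y, navSprayAng ε x y] k := by
  fin_cases k
  · simpa [Matrix.mulVec, dotProduct, Fin.sum_univ_two, fundMatrix] using spray_lowered_zero h
  · simpa [Matrix.mulVec, dotProduct, Fin.sum_univ_two, fundMatrix] using spray_lowered_one h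

theorem sprayCoeff_navMetric (h : (x, y) ∈ navDomain ε) (i : Fin 2) :
    sprayCoeff (navMetric ε) i x y = ![navSprayRad ε x y, navSprayAng ε x y] i := by
  have hdet : IsUnit (fundMatrix (navMetric ε) x y).det :=
    (Matrix.isUnit_iff_isUnit_det _).1 (posDef_fundMatrix_navMetric h).isUnit
  have hinv : Matrix.mulVec (fundMatrix (navMetric ε) x y)⁻¹
      (Matrix.mulVec (fundMatrix (navMetric ε) x y) ![navSprayRad ε x y, navSprayAng ε x y]) i
      = ![navSprayRad ε x y, navSprayAng ε x y] i := by
    rw [Matrix.mulVec_mulVec, Matrix.nonsing_inv_mul _ hdet, Matrix.one_mulVec]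
  rw [← hinv, sprayCoeff, Finset.mul_sum, Matrix.mulVec, dotProduct]
  refine Finset.sum_congr rfl fun k _ => ?_
  rw [← lowered_spray_eq h k]
  ring

theorem isNavTerm_sprayCoeff_zero : IsNavTerm ε (sprayCoeff (navMetric ε) 0) 0
    (fun r m n => sprayRadA ε r * m ^ 2 + sprayRadB ε r * n ^ 2) (sprayRadMixed ε)
    (fun _ _ n => n) :=
  fun _ _ h => sprayCoeff_navMetric h 0

theorem isNavTerm_sprayCoeff_one : IsNavTerm ε (sprayCoeff (navMetric ε) 1) 0
    (fun r m n => sprayAng ε r * m * n) (sprayAngMixed ε) (fun _ m _ => m) :=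
  fun _ _ h => sprayCoeff_navMetric h 1

end NavigationSpray

section NavigationCurvature

variable {ε : ℝ} {x y : Fin 2 → ℝ}

theorem isNavTerm_pdy_zero_sprayCoeff_zero :
    IsNavTerm ε (pdy 0 (sprayCoeff (navMetric ε) 0)) 1
      (fun r m _ => 2 * sprayRadA ε r * m) (sprayRadMixed ε) (fun r m n => navA ε r * m * n) :=
  isNavTerm_sprayCoeff_zero.pdy_zero (z' := fun _ _ _ => 0)
    (fun r m n => hasDerivAt_of_cubic (sprayRadB ε r * n ^ 2) 0 (sprayRadA ε r) 0
      (fun s => by ring) (by ring))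
    (fun r m n => hasDerivAt_const _ _) (fun r m n => by norm_num; ring)

theorem isNavTerm_pdy_one_sprayCoeff_zero :
    IsNavTerm ε (pdy 1 (sprayCoeff (navMetric ε) 0)) 1
      (fun r _ n => 2 * sprayRadB ε r * n) (sprayRadMixed ε)
      (fun r m n => navA ε r * m ^ 2 + 2 * navB r * n ^ 2) :=
  isNavTerm_sprayCoeff_zero.pdy_one (z' := fun _ _ _ => 1)
    (fun r m n => hasDerivAt_of_cubic (sprayRadA ε r * m ^ 2) 0 (sprayRadB ε r) 0
      (fun s => by ring) (by ring))
    (fun r m n => hasDerivAt_id' _) (fun r m n => by norm_num; ring)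

theorem isNavTerm_pdy_zero_sprayCoeff_one :
    IsNavTerm ε (pdy 0 (sprayCoeff (navMetric ε) 1)) 1
      (fun r _ n => sprayAng ε r * n) (sprayAngMixed ε)
      (fun r m n => 2 * navA ε r * m ^ 2 + navB r * n ^ 2) :=
  isNavTerm_sprayCoeff_one.pdy_zero (z' := fun _ _ _ => 1)
    (fun r m n => hasDerivAt_of_cubic 0 (sprayAng ε r * n) 0 0 (fun s => by ring) (by ring))
    (fun r m n => hasDerivAt_id' _) (fun r m n => by norm_num; ring)

theorem isNavTerm_pdy_one_sprayCoeff_one :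
    IsNavTerm ε (pdy 1 (sprayCoeff (navMetric ε) 1)) 1
      (fun r m _ => sprayAng ε r * m) (sprayAngMixed ε) (fun r m n => navB r * m * n) :=
  isNavTerm_sprayCoeff_one.pdy_one (z' := fun _ _ _ => 0)
    (fun r m n => hasDerivAt_of_cubic 0 (sprayAng ε r * m) 0 0 (fun s => by ring) (by ring))
    (fun r m n => hasDerivAt_const _ _) (fun r m n => by norm_num; ring)

theorem isNavTerm_pdy_zero_pdy_zero_sprayCoeff_zero :
    IsNavTerm ε (pdy 0 (pdy 0 (sprayCoeff (navMetric ε) 0))) 2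
      (fun r _ _ => 2 * sprayRadA ε r) (sprayRadMixed ε)
      (fun r _ n => navA ε r * navB r * n ^ 3) :=
  isNavTerm_pdy_zero_sprayCoeff_zero.pdy_zero (z' := fun r _ n => navA ε r * n)
    (fun r m n => hasDerivAt_of_cubic 0 (2 * sprayRadA ε r) 0 0 (fun s => by ring) (by ring))
    (fun r m n => hasDerivAt_of_cubic 0 (navA ε r * n) 0 0 (fun s => by ring) (by ring))
    (fun r m n => by norm_num; ring)

theorem isNavTerm_pdy_one_pdy_zero_sprayCoeff_zero :
    IsNavTerm ε (pdy 1 (pdy 0 (sprayCoeff (navMetric ε) 0))) 2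
      (fun _ _ _ => 0) (sprayRadMixed ε) (fun r m _ => navA ε r ^ 2 * m ^ 3) :=
  isNavTerm_pdy_zero_sprayCoeff_zero.pdy_one (z' := fun r m _ => navA ε r * m)
    (fun r m n => hasDerivAt_const _ _)
    (fun r m n => hasDerivAt_of_cubic 0 (navA ε r * m) 0 0 (fun s => by ring) (by ring))
    (fun r m n => by norm_num; ring)

theorem isNavTerm_pdy_zero_pdy_one_sprayCoeff_zero :
    IsNavTerm ε (pdy 0 (pdy 1 (sprayCoeff (navMetric ε) 0))) 2
      (fun _ _ _ => 0) (sprayRadMixed ε) (fun r m _ => navA ε r ^ 2 * m ^ 3) :=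
  isNavTerm_pdy_one_sprayCoeff_zero.pdy_zero (z' := fun r m _ => 2 * navA ε r * m)
    (fun r m n => hasDerivAt_const _ _)
    (fun r m n => hasDerivAt_of_cubic (2 * navB r * n ^ 2) 0 (navA ε r) 0
      (fun s => by ring) (by ring))
    (fun r m n => by norm_num; ring)

theorem isNavTerm_pdy_one_pdy_one_sprayCoeff_zero :
    IsNavTerm ε (pdy 1 (pdy 1 (sprayCoeff (navMetric ε) 0))) 2
      (fun r _ _ => 2 * sprayRadB ε r) (sprayRadMixed ε)
      (fun r m n => navB r * n * (3 * navA ε r * m ^ 2 + 2 * navB r * n ^ 2)) :=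
  isNavTerm_pdy_one_sprayCoeff_zero.pdy_one (z' := fun r _ n => 4 * navB r * n)
    (fun r m n => hasDerivAt_of_cubic 0 (2 * sprayRadB ε r) 0 0 (fun s => by ring) (by ring))
    (fun r m n => hasDerivAt_of_cubic (navA ε r * m ^ 2) 0 (2 * navB r) 0
      (fun s => by ring) (by ring))
    (fun r m n => by norm_num; ring)

theorem isNavTerm_pdy_zero_pdy_zero_sprayCoeff_one :
    IsNavTerm ε (pdy 0 (pdy 0 (sprayCoeff (navMetric ε) 1))) 2
      (fun _ _ _ => 0) (sprayAngMixed ε)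
      (fun r m n => navA ε r * m * (2 * navA ε r * m ^ 2 + 3 * navB r * n ^ 2)) :=
  isNavTerm_pdy_zero_sprayCoeff_one.pdy_zero (z' := fun r m _ => 4 * navA ε r * m)
    (fun r m n => hasDerivAt_const _ _)
    (fun r m n => hasDerivAt_of_cubic (navB r * n ^ 2) 0 (2 * navA ε r) 0
      (fun s => by ring) (by ring))
    (fun r m n => by norm_num; ring)

theorem isNavTerm_pdy_one_pdy_zero_sprayCoeff_one :
    IsNavTerm ε (pdy 1 (pdy 0 (sprayCoeff (navMetric ε) 1))) 2
      (fun r _ _ => sprayAng ε r) (sprayAngMixed ε) (fun r _ n => navB r ^ 2 * n ^ 3) :=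
  isNavTerm_pdy_zero_sprayCoeff_one.pdy_one (z' := fun r _ n => 2 * navB r * n)
    (fun r m n => hasDerivAt_of_cubic 0 (sprayAng ε r) 0 0 (fun s => by ring) (by ring))
    (fun r m n => hasDerivAt_of_cubic (2 * navA ε r * m ^ 2) 0 (navB r) 0
      (fun s => by ring) (by ring))
    (fun r m n => by norm_num; ring)

theorem isNavTerm_pdy_zero_pdy_one_sprayCoeff_one :
    IsNavTerm ε (pdy 0 (pdy 1 (sprayCoeff (navMetric ε) 1))) 2
      (fun r _ _ => sprayAng ε r) (sprayAngMixed ε) (fun r _ n => navB r ^ 2 * n ^ 3) :=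
  isNavTerm_pdy_one_sprayCoeff_one.pdy_zero (z' := fun r _ n => navB r * n)
    (fun r m n => hasDerivAt_of_cubic 0 (sprayAng ε r) 0 0 (fun s => by ring) (by ring))
    (fun r m n => hasDerivAt_of_cubic 0 (navB r * n) 0 0 (fun s => by ring) (by ring))
    (fun r m n => by norm_num; ring)

theorem isNavTerm_pdy_one_pdy_one_sprayCoeff_one :
    IsNavTerm ε (pdy 1 (pdy 1 (sprayCoeff (navMetric ε) 1))) 2
      (fun _ _ _ => 0) (sprayAngMixed ε) (fun r m _ => navA ε r * navB r * m ^ 3) :=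
  isNavTerm_pdy_one_sprayCoeff_one.pdy_one (z' := fun r m _ => navB r * m)
    (fun r m n => hasDerivAt_const _ _)
    (fun r m n => hasDerivAt_of_cubic 0 (navB r * m) 0 0 (fun s => by ring) (by ring))
    (fun r m n => by norm_num; ring)

set_option maxRecDepth 100000 in
set_option maxHeartbeats 4000000 in
theorem riemCoeff_navMetric_zero_zero (h : (x, y) ∈ navDomain ε) :
    riemCoeff (navMetric ε) 0 0 x y
      = navMetric ε x y ^ 2 - navMetric ε x y * pdy 0 (navMetric ε) x y * y 0 := by
  have hr : x 0 ≠ 0 := ne_of_gt h.1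
  have hD : navDen ε (x 0) ≠ 0 := ne_of_gt h.2.1
  have hw : 1 + x 0 ^ 2 ≠ 0 := by positivity
  have hT := (navForm_num_pos h).ne'
  have hA := diagNorm_sq (navForm_pos h)
  simp only [riemCoeff, Fin.sum_univ_two, isNavTerm_pdy_zero_sprayCoeff_zero.pdx_one h]
  rw [isNavTerm_sprayCoeff_zero.pdx_zero h
      (((hasDerivAt_sprayRadA hD).mul_const _).add ((hasDerivAt_sprayRadB hD).mul_const _))
      (hasDerivAt_sprayRadMixed hD) (hasDerivAt_const _ _),
    isNavTerm_pdy_zero_sprayCoeff_zero.pdx_zero h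
      (((hasDerivAt_sprayRadA hD).const_mul 2).mul_const _)
      (hasDerivAt_sprayRadMixed hD) ((hasDerivAt_navA.mul_const _).mul_const _),
    isNavTerm_sprayCoeff_zero x y h, isNavTerm_sprayCoeff_one x y h,
    isNavTerm_pdy_zero_pdy_zero_sprayCoeff_zero x y h,
    isNavTerm_pdy_one_pdy_zero_sprayCoeff_zero x y h, isNavTerm_pdy_zero_sprayCoeff_zero x y h,
    isNavTerm_pdy_one_sprayCoeff_zero x y h, isNavTerm_pdy_zero_sprayCoeff_one x y h,
    pdy_zero_navMetric h, navMetric_eq_randers]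
  simp only [randersTerm]
  generalize diagNorm (navA ε (x 0)) (navB (x 0)) (y 0) (y 1) = A at hA ⊢
  generalize y 0 = m at *
  generalize y 1 = n at *
  generalize x 0 = r at *
  generalize hP : navA ε r * m ^ 2 + navB r * n ^ 2 = P at *
  refine eq_of_sq_eq_of_sub_eq (
      2 * (sprayRadMixed ε r * n) * (sprayRadMixed ε r * (navA ε r * navB r * n ^ 3)) / P ^ 2
    + 2 * (sprayAngMixed ε r * m) * (sprayRadMixed ε r * (navA ε r ^ 2 * m ^ 3)) / P ^ 2
    - sprayRadMixed ε r * (navA ε r * m * n)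
      * (sprayRadMixed ε r * (navA ε r * m * n)) / P ^ 2
    - sprayRadMixed ε r * (navA ε r * m ^ 2 + 2 * navB r * n ^ 2)
      * (sprayAngMixed ε r * (2 * navA ε r * m ^ 2 + navB r * n ^ 2)) / P ^ 2
    - (1 / navDen ε r) ^ 2
    + (1 / navDen ε r) ^ 2 * (navA ε r * m) * m / P) hA ?_
  clear hA h
  subst hP
  simp only [sprayRadA, sprayRadB, sprayRadMixed, sprayAng,
    sprayAngMixed, navA, navB, navA_form_eq, Nat.cast_zero, Nat.cast_one,
    Nat.reduceAdd, pow_one, pow_zero, div_one]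
  generalize hDr : navDen ε r = D at *
  generalize hwr : 1 + r ^ 2 = w at *
  generalize hTr : D * m ^ 2 + r ^ 2 * w ^ 2 * n ^ 2 = T at *
  field_simp
  simp only [← hTr, ← hwr, ← hDr, navDen]
  ring

set_option maxRecDepth 100000 in
set_option maxHeartbeats 4000000 in
theorem riemCoeff_navMetric_zero_one (h : (x, y) ∈ navDomain ε) :
    riemCoeff (navMetric ε) 0 1 x y
      = -(navMetric ε x y * pdy 1 (navMetric ε) x y * y 0) := by
  have hr : x 0 ≠ 0 := ne_of_gt h.1
  have hD : navDen ε (x 0) ≠ 0 := ne_of_gt h.2.1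
  have hw : 1 + x 0 ^ 2 ≠ 0 := by positivity
  have hT := (navForm_num_pos h).ne'
  have hA := diagNorm_sq (navForm_pos h)
  simp only [riemCoeff, Fin.sum_univ_two, isNavTerm_pdy_one_sprayCoeff_zero.pdx_one h,
    isNavTerm_sprayCoeff_zero.pdx_one h]
  rw [isNavTerm_pdy_one_sprayCoeff_zero.pdx_zero h
      (((hasDerivAt_sprayRadB hD).const_mul 2).mul_const _)
      (hasDerivAt_sprayRadMixed hD)
      ((hasDerivAt_navA.mul_const _).add ((hasDerivAt_navB.const_mul 2).mul_const _)),
    isNavTerm_sprayCoeff_zero x y h, isNavTerm_sprayCoeff_one x y h,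
    isNavTerm_pdy_zero_pdy_one_sprayCoeff_zero x y h,
    isNavTerm_pdy_one_pdy_one_sprayCoeff_zero x y h, isNavTerm_pdy_zero_sprayCoeff_zero x y h,
    isNavTerm_pdy_one_sprayCoeff_zero x y h, isNavTerm_pdy_one_sprayCoeff_one x y h,
    pdy_one_navMetric h, navMetric_eq_randers]
  simp only [randersTerm]
  generalize diagNorm (navA ε (x 0)) (navB (x 0)) (y 0) (y 1) = A at hA ⊢
  generalize y 0 = m at *
  generalize y 1 = n at *
  generalize x 0 = r at *
  generalize hP : navA ε r * m ^ 2 + navB r * n ^ 2 = P at *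
  refine eq_of_sq_eq_of_sub_eq (
      2 * (sprayRadMixed ε r * n) * (sprayRadMixed ε r * (navA ε r ^ 2 * m ^ 3)) / P ^ 2
    + 2 * (sprayAngMixed ε r * m)
      * (sprayRadMixed ε r * (navB r * n * (3 * navA ε r * m ^ 2 + 2 * navB r * n ^ 2))) / P ^ 2
    - sprayRadMixed ε r * (navA ε r * m * n)
      * (sprayRadMixed ε r * (navA ε r * m ^ 2 + 2 * navB r * n ^ 2)) / P ^ 2
    - sprayRadMixed ε r * (navA ε r * m ^ 2 + 2 * navB r * n ^ 2)
      * (sprayAngMixed ε r * (navB r * m * n)) / P ^ 2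
    + (1 / navDen ε r) ^ 2 * (navB r * n) * m / P) hA ?_
  clear hA h
  subst hP
  simp only [sprayRadA, sprayRadB, sprayRadMixed, sprayAng,
    sprayAngMixed, navA, navB, navA_form_eq, Nat.cast_one,
    Nat.reduceAdd, pow_one, pow_zero, div_one]
  generalize hDr : navDen ε r = D at *
  generalize hwr : 1 + r ^ 2 = w at *
  generalize hTr : D * m ^ 2 + r ^ 2 * w ^ 2 * n ^ 2 = T at *
  field_simp
  simp only [← hTr, ← hwr, ← hDr, navDen]
  ring

set_option maxRecDepth 100000 in
set_option maxHeartbeats 4000000 in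
theorem riemCoeff_navMetric_one_zero (h : (x, y) ∈ navDomain ε) :
    riemCoeff (navMetric ε) 1 0 x y
      = -(navMetric ε x y * pdy 0 (navMetric ε) x y * y 1) := by
  have hr : x 0 ≠ 0 := ne_of_gt h.1
  have hD : navDen ε (x 0) ≠ 0 := ne_of_gt h.2.1
  have hw : 1 + x 0 ^ 2 ≠ 0 := by positivity
  have hT := (navForm_num_pos h).ne'
  have hA := diagNorm_sq (navForm_pos h)
  simp only [riemCoeff, Fin.sum_univ_two, isNavTerm_pdy_zero_sprayCoeff_one.pdx_one h]
  rw [isNavTerm_sprayCoeff_one.pdx_zero h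
      (((hasDerivAt_sprayAng hr hD).mul_const _).mul_const _)
      (hasDerivAt_sprayAngMixed hr hD) (hasDerivAt_const _ _),
    isNavTerm_pdy_zero_sprayCoeff_one.pdx_zero h
      ((hasDerivAt_sprayAng hr hD).mul_const _)
      (hasDerivAt_sprayAngMixed hr hD)
      (((hasDerivAt_navA.const_mul 2).mul_const _).add (hasDerivAt_navB.mul_const _)),
    isNavTerm_sprayCoeff_zero x y h, isNavTerm_sprayCoeff_one x y h,
    isNavTerm_pdy_zero_pdy_zero_sprayCoeff_one x y h,
    isNavTerm_pdy_one_pdy_zero_sprayCoeff_one x y h, isNavTerm_pdy_zero_sprayCoeff_one x y h,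
    isNavTerm_pdy_zero_sprayCoeff_zero x y h, isNavTerm_pdy_one_sprayCoeff_one x y h,
    pdy_zero_navMetric h, navMetric_eq_randers]
  simp only [randersTerm]
  generalize diagNorm (navA ε (x 0)) (navB (x 0)) (y 0) (y 1) = A at hA ⊢
  generalize y 0 = m at *
  generalize y 1 = n at *
  generalize x 0 = r at *
  generalize hP : navA ε r * m ^ 2 + navB r * n ^ 2 = P at *
  refine eq_of_sq_eq_of_sub_eq (
      2 * (sprayRadMixed ε r * n)
      * (sprayAngMixed ε r * (navA ε r * m * (2 * navA ε r * m ^ 2 + 3 * navB r * n ^ 2))) / P ^ 2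
    + 2 * (sprayAngMixed ε r * m) * (sprayAngMixed ε r * (navB r ^ 2 * n ^ 3)) / P ^ 2
    - sprayAngMixed ε r * (2 * navA ε r * m ^ 2 + navB r * n ^ 2)
      * (sprayRadMixed ε r * (navA ε r * m * n)) / P ^ 2
    - sprayAngMixed ε r * (navB r * m * n)
      * (sprayAngMixed ε r * (2 * navA ε r * m ^ 2 + navB r * n ^ 2)) / P ^ 2
    + (1 / navDen ε r) ^ 2 * (navA ε r * m) * n / P) hA ?_
  clear hA h
  subst hP
  simp only [sprayRadA, sprayRadB, sprayRadMixed, sprayAng,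
    sprayAngMixed, navA, navB, navA_form_eq, Nat.cast_zero, Nat.cast_one,
    Nat.reduceAdd, pow_one, pow_zero, div_one]
  generalize hDr : navDen ε r = D at *
  generalize hwr : 1 + r ^ 2 = w at *
  generalize hTr : D * m ^ 2 + r ^ 2 * w ^ 2 * n ^ 2 = T at *
  field_simp
  simp only [← hTr, ← hwr, ← hDr, navDen]
  ring

set_option maxRecDepth 100000 in
set_option maxHeartbeats 4000000 in
theorem riemCoeff_navMetric_one_one (h : (x, y) ∈ navDomain ε) :
    riemCoeff (navMetric ε) 1 1 x y
      = navMetric ε x y ^ 2 - navMetric ε x y * pdy 1 (navMetric ε) x y * y 1 := by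
  have hr : x 0 ≠ 0 := ne_of_gt h.1
  have hD : navDen ε (x 0) ≠ 0 := ne_of_gt h.2.1
  have hw : 1 + x 0 ^ 2 ≠ 0 := by positivity
  have hT := (navForm_num_pos h).ne'
  have hA := diagNorm_sq (navForm_pos h)
  simp only [riemCoeff, Fin.sum_univ_two, isNavTerm_pdy_one_sprayCoeff_one.pdx_one h,
    isNavTerm_sprayCoeff_one.pdx_one h]
  rw [isNavTerm_pdy_one_sprayCoeff_one.pdx_zero h
      ((hasDerivAt_sprayAng hr hD).mul_const _)
      (hasDerivAt_sprayAngMixed hr hD) ((hasDerivAt_navB.mul_const _).mul_const _),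
    isNavTerm_sprayCoeff_zero x y h, isNavTerm_sprayCoeff_one x y h,
    isNavTerm_pdy_zero_pdy_one_sprayCoeff_one x y h,
    isNavTerm_pdy_one_pdy_one_sprayCoeff_one x y h, isNavTerm_pdy_zero_sprayCoeff_one x y h,
    isNavTerm_pdy_one_sprayCoeff_zero x y h, isNavTerm_pdy_one_sprayCoeff_one x y h,
    pdy_one_navMetric h, navMetric_eq_randers]
  simp only [randersTerm]
  generalize diagNorm (navA ε (x 0)) (navB (x 0)) (y 0) (y 1) = A at hA ⊢
  generalize y 0 = m at *
  generalize y 1 = n at *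
  generalize x 0 = r at *
  generalize hP : navA ε r * m ^ 2 + navB r * n ^ 2 = P at *
  refine eq_of_sq_eq_of_sub_eq (
      2 * (sprayRadMixed ε r * n) * (sprayAngMixed ε r * (navB r ^ 2 * n ^ 3)) / P ^ 2
    + 2 * (sprayAngMixed ε r * m) * (sprayAngMixed ε r * (navA ε r * navB r * m ^ 3)) / P ^ 2
    - sprayAngMixed ε r * (2 * navA ε r * m ^ 2 + navB r * n ^ 2)
      * (sprayRadMixed ε r * (navA ε r * m ^ 2 + 2 * navB r * n ^ 2)) / P ^ 2
    - sprayAngMixed ε r * (navB r * m * n)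
      * (sprayAngMixed ε r * (navB r * m * n)) / P ^ 2
    - (1 / navDen ε r) ^ 2
    + (1 / navDen ε r) ^ 2 * (navB r * n) * n / P) hA ?_
  clear hA h
  subst hP
  simp only [sprayRadA, sprayRadB, sprayRadMixed, sprayAng,
    sprayAngMixed, navA, navB, navA_form_eq, Nat.cast_one,
    Nat.reduceAdd, pow_one, pow_zero, div_one]
  generalize hDr : navDen ε r = D at *
  generalize hwr : 1 + r ^ 2 = w at *
  generalize hTr : D * m ^ 2 + r ^ 2 * w ^ 2 * n ^ 2 = T at *
  field_simp
  simp only [← hTr, ← hwr, ← hDr, navDen]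
  ring

end NavigationCurvature

/-- The Randers metric on `S²` obtained from Zermelo navigation on the round
sphere, in polar coordinates `x = (r,θ)`, `y = (μ,ν)`, has constant flag
curvature `K = 1`: its Riemann curvature satisfies
`R^i_k = F²δ^i_k − F(∂F/∂y^k)y^i`. -/
theorem flag_curvature_one_sphere_navigation (ε : ℝ)
    (F : (Fin 2 → ℝ) → (Fin 2 → ℝ) → ℝ)
    (hF : F = fun x y =>
      (Real.sqrt ((1 + (1 - ε ^ 2) * (x 0) ^ 2) * (y 0) ^ 2
            + (x 0) ^ 2 * (1 + (x 0) ^ 2) ^ 2 * (y 1) ^ 2) / Real.sqrt (1 + (x 0) ^ 2)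
          - ε * (x 0) ^ 2 * y 1) / (1 + (1 - ε ^ 2) * (x 0) ^ 2)) :
    ∀ x y : Fin 2 → ℝ, 0 < x 0 → 0 < 1 + (1 - ε ^ 2) * (x 0) ^ 2 → y ≠ 0 →
      0 < F x y ∧ (fundMatrix F x y).PosDef ∧
      ∀ i k : Fin 2, riemCoeff F i k x y
        = F x y ^ 2 * (if i = k then 1 else 0) - F x y * pdy k F x y * y i := by
  intro x y hr hD hy
  have h : (x, y) ∈ navDomain ε := ⟨hr, hD, hy⟩
  obtain rfl : F = navMetric ε := hF
  refine ⟨navMetric_pos h, posDef_fundMatrix_navMetric h, fun i k => ?_⟩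
  fin_cases i <;> fin_cases k
  · simpa using riemCoeff_navMetric_zero_zero h
  · simpa using riemCoeff_navMetric_zero_one h
  · simpa using riemCoeff_navMetric_one_zero h
  · simpa using riemCoeff_navMetric_one_one h
end
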